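/- arXiv:2006.14548 — 4 statements merged into one kernel-verified Lean document; each statement's English description precedes it below -/
import Mathlib

section
/- Let (Z_1, Z_2) be jointly Gaussian real random variables with mean zero, and let φ: R → R be a differentiable function such that E[φ'(Z_2)] and E[Z_1 φ(Z_2)] both exist (are finite). Then E[Z_1 φ(Z_2)] = Cov(Z_1, Z_2) · E[φ'(Z_2)]. -/
set_option autoImplicit false

open MeasureTheory ProbabilityTheory Matrix

/-- A continuous function whose product with a nonconstant affine function is integrable against a
finite measure is itself integrable. -/
lemma Continuous.integrable_of_affine_mul {μ : Measure ℝ} [IsFiniteMeasure μ] {ψ : ℝ → ℝ}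
    (hψ : Continuous ψ) {a b : ℝ} (ha : a ≠ 0)
    (h : Integrable (fun x => (a * x + b) * ψ x) μ) : Integrable ψ μ := by
  obtain ⟨M, hM⟩ := (isCompact_closedBall (0 : ℝ) ((1 + |b|) / |a|)).exists_bound_of_continuousOn
    hψ.continuousOn
  refine Integrable.mono' ((integrable_const |M|).add h.norm) hψ.aestronglyMeasurable
    (ae_of_all _ fun x => ?_)
  simp only [Pi.add_apply, Real.norm_eq_abs, abs_mul]
  by_cases hx : x ∈ Metric.closedBall (0 : ℝ) ((1 + |b|) / |a|)
  · have := hM x hx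
    rw [Real.norm_eq_abs] at this
    have h0 : 0 ≤ |a * x + b| * |ψ x| := by positivity
    linarith [le_abs_self M]
  · have hlt : 1 + |b| < |a| * |x| := by
      rw [mem_closedBall_zero_iff, Real.norm_eq_abs, not_le, div_lt_iff₀ (abs_pos.2 ha)] at hx
      linarith
    have h1 : 1 ≤ |a * x + b| := by
      have := abs_sub_abs_le_abs_sub (a * x) (-b)
      rw [abs_mul, abs_neg, sub_neg_eq_add] at this
      linarith
    nlinarith [abs_nonneg M, abs_nonneg (ψ x)]

lemma hasDerivAt_gaussianPDFReal_zero_one (x : ℝ) :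
    HasDerivAt (gaussianPDFReal 0 1) (-x * gaussianPDFReal 0 1 x) x := by
  have h : HasDerivAt (fun y : ℝ => -(y - 0) ^ 2 / (2 * ((1 : NNReal) : ℝ))) (-x) x := by
    convert! ((((hasDerivAt_id x).sub_const 0).pow 2).neg.div_const
      (2 * ((1 : NNReal) : ℝ))) using 1
    simp
    ring
  rw [gaussianPDFReal_def]
  convert! h.exp.const_mul (√(2 * Real.pi * ((1 : NNReal) : ℝ)))⁻¹ using 1
  ring

lemma integrable_gaussianReal_iff {ψ : ℝ → ℝ} :
    Integrable ψ (gaussianReal 0 1) ↔ Integrable fun x => gaussianPDFReal 0 1 x * ψ x := by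
  rw [gaussianReal_of_var_ne_zero _ one_ne_zero, integrable_withDensity_iff_integrable_smul'
    (measurable_gaussianPDF _ _) (ae_of_all _ fun _ => gaussianPDF_lt_top)]
  simp [toReal_gaussianPDF]

/-- Gaussian integration by parts in one dimension. -/
lemma integral_id_mul_gaussianReal {ψ ψ' : ℝ → ℝ} (hψ : ∀ x, HasDerivAt ψ (ψ' x) x)
    (h₀ : Integrable ψ (gaussianReal 0 1)) (h₁ : Integrable ψ' (gaussianReal 0 1))
    (h₂ : Integrable (fun x => x * ψ x) (gaussianReal 0 1)) :
    ∫ x, x * ψ x ∂gaussianReal 0 1 = ∫ x, ψ' x ∂gaussianReal 0 1 := by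
  rw [integrable_gaussianReal_iff] at h₀ h₁ h₂
  have key := integral_eq_zero_of_hasDerivAt_of_integrable
    (f := fun x => gaussianPDFReal 0 1 x * ψ x)
    (f' := fun x => gaussianPDFReal 0 1 x * ψ' x - gaussianPDFReal 0 1 x * (x * ψ x))
    (fun x => by
      convert! (hasDerivAt_gaussianPDFReal_zero_one x).mul (hψ x) using 1
      ring) (h₁.sub h₂) h₀
  rw [integral_sub h₁ h₂] at key
  simp only [integral_gaussianReal_eq_integral_smul one_ne_zero, smul_eq_mul]
  linarith

/-- Gaussian integration by parts against a linear combination of two independent standard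
Gaussians. -/
lemma integral_linear_mul_gaussianReal_prod {ψ ψ' : ℝ → ℝ} (hψ : ∀ x, HasDerivAt ψ (ψ' x) x)
    (a b : ℝ) (h₁ : Integrable ψ' (gaussianReal 0 1))
    (h₂ : Integrable (fun p : ℝ × ℝ => (a * p.1 + b * p.2) * ψ p.1)
      ((gaussianReal 0 1).prod (gaussianReal 0 1))) :
    ∫ p : ℝ × ℝ, (a * p.1 + b * p.2) * ψ p.1 ∂(gaussianReal 0 1).prod (gaussianReal 0 1)
      = a * ∫ x, ψ' x ∂gaussianReal 0 1 := by
  have hzero : ∫ p : ℝ × ℝ, ψ p.1 * (b * p.2) ∂(gaussianReal 0 1).prod (gaussianReal 0 1) = 0 := by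
    rw [integral_prod_mul ψ (fun y => b * y), integral_const_mul, integral_id_gaussianReal]
    simp
  rcases eq_or_ne a 0 with rfl | ha
  · simpa [mul_comm (ψ _)] using hzero
  have hcont : Continuous ψ := continuous_iff_continuousAt.2 fun x => (hψ x).continuousAt
  obtain ⟨y, hy⟩ := h₂.prod_left_ae.exists
  dsimp only at hy
  have h₀ : Integrable ψ (gaussianReal 0 1) := hcont.integrable_of_affine_mul ha hy
  have hmul : Integrable (fun x => x * ψ x) (gaussianReal 0 1) := by
    refine ((hy.sub (h₀.const_mul (b * y))).const_mul a⁻¹).congr (ae_of_all _ fun x => ?_)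
    simp only [Pi.sub_apply]
    field_simp
    ring
  have hid : Integrable (fun y : ℝ => b * y) (gaussianReal 0 1) :=
    ((memLp_id_gaussianReal 1).integrable le_rfl).const_mul b
  have hsplit : (fun p : ℝ × ℝ => (a * p.1 + b * p.2) * ψ p.1)
      = fun p => a * (p.1 * ψ p.1) + ψ p.1 * (b * p.2) := by
    funext p
    ring
  rw [hsplit, integral_add ((hmul.comp_fst _).const_mul a) (h₀.mul_prod hid), hzero, add_zero,
    integral_const_mul, integral_fun_fst (fun x => x * ψ x),
    integral_id_mul_gaussianReal hψ h₀ h₁ hmul]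
  simp

/-- A linear image of a standard Gaussian vector in the plane can be brought to triangular form. -/
lemma exists_map_mulVec_gaussianReal_eq (B : Matrix (Fin 2) (Fin 2) ℝ) :
    ∃ a b r : ℝ, Measure.map (fun g : Fin 2 → ℝ => (B.mulVec g 0, B.mulVec g 1))
          (Measure.pi fun _ : Fin 2 => gaussianReal 0 1)
      = Measure.map (fun p : ℝ × ℝ => (a * p.1 + b * p.2, r * p.1))
          ((gaussianReal 0 1).prod (gaussianReal 0 1)) := by
  set z : ℂ := ⟨B 1 0, B 1 1⟩
  set θ := z.arg
  have hcos : ‖z‖ * Real.cos θ = B 1 0 := z.norm_mul_cos_arg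
  have hsin : ‖z‖ * Real.sin θ = B 1 1 := z.norm_mul_sin_arg
  refine ⟨B 0 0 * Real.cos θ + B 0 1 * Real.sin θ, -B 0 0 * Real.sin θ + B 0 1 * Real.cos θ,
    ‖z‖, ?_⟩
  rw [← IsGaussian.map_rotation_eq_self (μ := gaussianReal 0 1) (by simp) θ,
    ← (measurePreserving_finTwoArrow (gaussianReal 0 1)).map_eq,
    Measure.map_map (by fun_prop) (by fun_prop), Measure.map_map (by fun_prop) (by fun_prop)]
  congr 1
  funext g
  simp only [Function.comp_apply, MeasurableEquiv.finTwoArrow_apply,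
    ContinuousLinearMap.rotation_apply, smul_eq_mul, Matrix.mulVec, dotProduct, Fin.sum_univ_two]
  rw [← hcos, ← hsin]
  ext
  · linear_combination (-B 0 0 * g 0 - B 0 1 * g 1) * Real.sin_sq_add_cos_sq θ
  · ring

/-- **Stein's lemma.** Let `(Z₁, Z₂)` be jointly Gaussian with mean zero (i.e. their joint
law is the image of a standard Gaussian vector under a linear map `B`), and let `φ` be a
differentiable function such that `E[φ' (Z₂)]` and `E[Z₁ φ (Z₂)]` exist.  Then
`E[Z₁ φ (Z₂)] = Cov (Z₁, Z₂) · E[φ' (Z₂)]`, where `Cov (Z₁, Z₂) = E[Z₁ Z₂]`. -/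
theorem stein_lemma
    {Ω : Type*} [MeasureSpace Ω] [IsProbabilityMeasure (volume : Measure Ω)]
    (Z₁ Z₂ : Ω → ℝ) (B : Matrix (Fin 2) (Fin 2) ℝ)
    (hlaw : Measure.map (fun ω => (Z₁ ω, Z₂ ω)) volume
      = Measure.map (fun g : Fin 2 → ℝ => (B.mulVec g 0, B.mulVec g 1))
          (Measure.pi fun _ : Fin 2 => gaussianReal 0 1))
    (φ φ' : ℝ → ℝ) (hφ : ∀ x : ℝ, HasDerivAt φ (φ' x) x)
    (hint₁ : Integrable (fun ω => φ' (Z₂ ω)))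
    (hint₂ : Integrable (fun ω => Z₁ ω * φ (Z₂ ω))) :
    ∫ ω, Z₁ ω * φ (Z₂ ω) = (∫ ω, Z₁ ω * Z₂ ω) * ∫ ω, φ' (Z₂ ω) := by
  obtain ⟨a, b, r, hB⟩ := exists_map_mulVec_gaussianReal_eq B
  rw [hB] at hlaw
  have hL : Measurable fun p : ℝ × ℝ => (a * p.1 + b * p.2, r * p.1) := by fun_prop
  have hZ : AEMeasurable (fun ω => (Z₁ ω, Z₂ ω)) := by
    have := Measure.isProbabilityMeasure_map
      (μ := (gaussianReal 0 1).prod (gaussianReal 0 1)) hL.aemeasurable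
    exact AEMeasurable.of_map_ne_zero (hlaw ▸ IsProbabilityMeasure.ne_zero _)
  have hident : IdentDistrib (fun ω => (Z₁ ω, Z₂ ω))
      (fun p : ℝ × ℝ => (a * p.1 + b * p.2, r * p.1)) volume
      ((gaussianReal 0 1).prod (gaussianReal 0 1)) := ⟨hZ, hL.aemeasurable, hlaw⟩
  have hφ_meas : Measurable φ :=
    (continuous_iff_continuousAt.2 fun x => (hφ x).continuousAt).measurable
  have hderiv_meas : Measurable φ' := by
    rw [← funext fun x => (hφ x).deriv]
    exact measurable_deriv φ
  have id₁ := hident.comp (u := fun q : ℝ × ℝ => φ' q.2) (by fun_prop)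
  have id₂ := hident.comp (u := fun q : ℝ × ℝ => q.1 * φ q.2) (by fun_prop)
  have id₃ := hident.comp (u := fun q : ℝ × ℝ => q.1 * q.2) (by fun_prop)
  have e₁ := id₁.integral_eq
  have e₂ := id₂.integral_eq
  have e₃ := id₃.integral_eq
  have i₁ := id₁.integrable_iff.1 hint₁
  have i₂ := id₂.integrable_iff.1 hint₂
  simp only [Function.comp_def] at e₁ e₂ e₃ i₁ i₂
  have i₁' : Integrable (fun x => φ' (r * x)) (gaussianReal 0 1) :=
    i₁.prod_left_ae.exists.choose_spec
  have hderiv (x : ℝ) : HasDerivAt (fun y => φ (r * y)) (r * φ' (r * x)) x := by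
    convert! (hφ (r * x)).comp x ((hasDerivAt_id x).const_mul r) using 1
    ring
  have hlin (x : ℝ) : HasDerivAt (fun y => r * y) r x := by
    simpa using (hasDerivAt_id x).const_mul r
  have hsq : MemLp (fun x : ℝ => x) 2 (gaussianReal 0 1) := memLp_id_gaussianReal 2
  have i₃ : Integrable (fun p : ℝ × ℝ => (a * p.1 + b * p.2) * (r * p.1))
      ((gaussianReal 0 1).prod (gaussianReal 0 1)) :=
    (((hsq.comp_fst _).const_mul a).add ((hsq.comp_snd _).const_mul b)).integrable_mul
      ((hsq.comp_fst _).const_mul r)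
  rw [e₁, e₂, e₃, integral_fun_fst (fun x => φ' (r * x)),
    integral_linear_mul_gaussianReal_prod hderiv a b (i₁'.const_mul r) i₂,
    integral_linear_mul_gaussianReal_prod hlin a b (integrable_const _) i₃,
    integral_const_mul]
  simp
  ring
end

section
/- Let A ∈ R^{n×m} be a random matrix with i.i.d. entries A_{ij} ~ N(0, σ²). Let Q ∈ R^{m×q} and P ∈ R^{n×p} be fixed matrices, and let Ã be an independent copy of A. Define Π_Q = Q Q⁺ and Π_P = P P⁺ (the orthogonal projections onto the column spaces of Q and P), and Π_Q^⊥ = I − Π_Q, Π_P^⊥ = I − Π_P, where Q⁺ and P⁺ denote Moore–Penrose pseudoinverses. For matrices Y ∈ R^{n×q} and X ∈ R^{m×p}, define E(Y, X) = Y Q⁺ + P^{+T} Xᵀ − P^{+T} Pᵀ Y Q⁺. Then, conditional on the σ-algebra generated by (AQ, AᵀP), the matrix A is equal in distribution to E(AQ, AᵀP) + Π_P^⊥ Ã Π_Q^⊥; that is, for every bounded measurable function F on R^{n×m} and every bounded measurable function G on R^{n×q} × R^{m×p}, E[F(A) · G(AQ, AᵀP)] = E[F(E(AQ, AᵀP)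 + Π_P^⊥ Ã Π_Q^⊥) · G(AQ, AᵀP)]. -/
set_option autoImplicit false

open MeasureTheory ProbabilityTheory Matrix

open scoped Kronecker

/-- If `C Dᵀ = 0`, the linear images `C X` and `D X` of a vector `X` with independent centred
Gaussian entries of common variance are independent. -/
theorem indepFun_mulVec_of_mul_transpose_eq_zero {Ω ι κ₁ κ₂ : Type*} [MeasurableSpace Ω]
    {μ : Measure Ω} [Fintype ι] [Fintype κ₁] [Fintype κ₂] {X : ι → Ω → ℝ} {v : NNReal}
    (hX : iIndepFun X μ) (hlaw : ∀ i, HasLaw (X i) (gaussianReal 0 v) μ)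
    (C : Matrix κ₁ ι ℝ) (D : Matrix κ₂ ι ℝ) (hCD : C * Dᵀ = 0) :
    IndepFun (fun ω => C *ᵥ fun i => X i ω) (fun ω => D *ᵥ fun i => X i ω) μ := by
  classical
  have := hX.isProbabilityMeasure
  have hgauss (i : ι) : HasGaussianLaw (X i) μ := (hlaw i).hasGaussianLaw
  have hmem (i : ι) : MemLp (X i) 2 μ := (hgauss i).memLp_two
  let T : (ι → ℝ) →L[ℝ] (κ₁ → ℝ) × (κ₂ → ℝ) :=
    LinearMap.toContinuousLinearMap (C.mulVecLin.prod D.mulVecLin)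
  have hjoint : HasGaussianLaw (fun ω => T fun i => X i ω) μ :=
    (iIndepFun.hasGaussianLaw hgauss hX).map_fun T
  have hcov (i j : ι) : cov[X i, X j; μ] = if i = j then (v : ℝ) else 0 := by
    split_ifs with h
    · subst h
      rw [covariance_self (hlaw i).aemeasurable, (hlaw i).variance_eq, variance_id_gaussianReal]
    · exact (hX.indepFun h).covariance_eq_zero (hmem i) (hmem j)
  refine HasGaussianLaw.indepFun_of_covariance_eval
    (X := fun a ω => ∑ i, C a i * X i ω) (Y := fun b ω => ∑ i, D b i * X i ω) hjoint fun a b => ?_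
  rw [covariance_fun_sum_fun_sum (fun i => (hmem i).const_mul _) (fun i => (hmem i).const_mul _)]
  have h : ∑ i, D b i * C a i = 0 := by
    simpa only [mul_apply, transpose_apply, Matrix.zero_apply, mul_comm]
      using congrFun (congrFun hCD a) b
  simp only [covariance_const_mul_left, covariance_const_mul_right, hcov, mul_ite, mul_zero,
    Finset.sum_ite_eq, Finset.mem_univ, if_true]
  simp only [← mul_assoc, ← Finset.sum_mul, h, zero_mul]

/-- The coordinates of a random vector with product law are independent and have the marginal
laws. -/
theorem iIndepFun_and_map_eq_of_map_eq_pi {Ω ι : Type*} [MeasurableSpace Ω] {μ : Measure Ω}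
    [IsProbabilityMeasure μ] [Fintype ι] {E : ι → Type*} [∀ i, MeasurableSpace (E i)]
    {ν : ∀ i, Measure (E i)} [∀ i, IsProbabilityMeasure (ν i)] {X : Ω → ∀ i, E i}
    (hX : Measurable X) (h : μ.map X = Measure.pi ν) :
    iIndepFun (fun i ω => X ω i) μ ∧ ∀ i, μ.map (fun ω => X ω i) = ν i := by
  have hlaw (i : ι) : μ.map (fun ω => X ω i) = ν i := by
    rw [← (measurePreserving_eval ν i).map_eq, ← h, Measure.map_map (measurable_pi_apply i) hX]
    rfl
  refine ⟨(iIndepFun_iff_map_fun_eq_pi_map fun i =>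
    ((measurable_pi_apply i).comp hX).aemeasurable).2 ?_, hlaw⟩
  exact h.trans (congrArg Measure.pi (funext fun i => (hlaw i).symm))

/-- For symmetric idempotent `U` and `V`, the part `U A V` of a matrix `A` with i.i.d. centred
Gaussian entries is independent of the remainder `A - U A V`. -/
theorem indepFun_sub_mul_mul {Ω ι κ : Type*} [MeasurableSpace Ω] {μ : Measure Ω}
    [IsProbabilityMeasure μ] [Fintype ι] [Fintype κ] {v : NNReal} {A : Ω → ι → κ → ℝ}
    (hA : Measurable A)
    (hlaw : μ.map A = Measure.pi fun _ : ι => Measure.pi fun _ : κ => gaussianReal 0 v)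
    {U : Matrix ι ι ℝ} {V : Matrix κ κ ℝ} (hU : Uᵀ = U) (hV : Vᵀ = V)
    (hUU : U * U = U) (hVV : V * V = V) :
    IndepFun (fun ω i j => (of (A ω) - U * of (A ω) * V) i j)
      (fun ω i j => (U * of (A ω) * V) i j) μ := by
  classical
  obtain ⟨hrows, hrow⟩ := iIndepFun_and_map_eq_of_map_eq_pi hA hlaw
  have hmeas (i : ι) : Measurable fun ω => A ω i := (measurable_pi_apply i).comp hA
  have hmeas' (i : ι) (j : κ) : Measurable fun ω => A ω i j :=
    (measurable_pi_apply j).comp (hmeas i)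
  have hentry (i : ι) := iIndepFun_and_map_eq_of_map_eq_pi (hmeas i) (hrow i)
  have hindep : iIndepFun (fun (p : κ × ι) ω => A ω p.2 p.1) μ :=
    (iIndepFun_uncurry' (X := fun i j ω => A ω i j) hmeas' hrows fun i => (hentry i).1).precomp
      (Prod.swap_injective)
  have key := indepFun_mulVec_of_mul_transpose_eq_zero hindep
    (fun p => ⟨(hmeas' p.2 p.1).aemeasurable, (hentry p.2).2 p.1⟩)
    (1 - V ⊗ₖ U) (V ⊗ₖ U) (by
      rw [← kroneckerMap_transpose, hU, hV, Matrix.sub_mul, ← mul_kronecker_mul, hUU, hVV,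
        Matrix.one_mul, sub_self])
  have hvec (ω : Ω) : (V ⊗ₖ U) *ᵥ vec (of (A ω)) = vec (U * of (A ω) * V) := by
    rw [kronecker_mulVec_vec, hV]
  have hunvec : Measurable fun (x : κ × ι → ℝ) (i : ι) (j : κ) => x (j, i) := by fun_prop
  convert key.comp hunvec hunvec using 1
  · funext ω i j
    change _ = ((1 - V ⊗ₖ U) *ᵥ vec (of (A ω))) (j, i)
    rw [sub_mulVec, one_mulVec, hvec]
    rfl
  · funext ω i j
    change _ = ((V ⊗ₖ U) *ᵥ vec (of (A ω))) (j, i)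
    rw [hvec]
    rfl

/-- Multiplication by fixed matrices on both sides is measurable. -/
theorem measurable_mul_of_mul {ι κ ι' κ' : Type*} [Fintype ι] [Fintype κ]
    (U : Matrix ι' ι ℝ) (V : Matrix κ κ' ℝ) :
    Measurable fun (x : ι → κ → ℝ) i j => (U * of x * V) i j := by
  refine measurable_pi_lambda _ fun i => measurable_pi_lambda _ fun j => ?_
  simp only [mul_apply, of_apply]
  fun_prop

/-- **Gaussian conditioning trick for random matrices.** Let `A` be a random `n × m` matrix
with i.i.d. `N(0, σ²)` entries and `Ã` an independent copy of `A`.  Let `Q, P` be fixed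
matrices with Moore–Penrose pseudoinverses `Qp, Pp`, and set
`E (Y, X) = Y Q⁺ + P⁺ᵀ Xᵀ − P⁺ᵀ Pᵀ Y Q⁺`, `Π_Q^⊥ = I − Q Q⁺`, `Π_P^⊥ = I − P P⁺`.
Then conditionally on `(A Q, Aᵀ P)`, `A` is distributed as
`E (A Q, Aᵀ P) + Π_P^⊥ Ã Π_Q^⊥`: for all bounded measurable `F`, `G`,
`E[F(A) G(AQ, AᵀP)] = E[F(E(AQ, AᵀP) + Π_P^⊥ Ã Π_Q^⊥) G(AQ, AᵀP)]`. -/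
theorem gaussian_matrix_conditioning_trick
    {Ω : Type*} [MeasureSpace Ω] [IsProbabilityMeasure (volume : Measure Ω)]
    (n m q₀ p₀ : ℕ) (v : NNReal) (hv : 0 < v)
    (A Atil : Ω → Fin n → Fin m → ℝ)
    (hAmeas : Measurable A) (hAtilmeas : Measurable Atil)
    (hAlaw : Measure.map A volume
      = Measure.pi fun _ : Fin n => Measure.pi fun _ : Fin m => gaussianReal 0 v)
    (hAtillaw : Measure.map Atil volume
      = Measure.pi fun _ : Fin n => Measure.pi fun _ : Fin m => gaussianReal 0 v)
    (hindep : IndepFun A Atil volume)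
    (Q : Matrix (Fin m) (Fin q₀) ℝ) (Qp : Matrix (Fin q₀) (Fin m) ℝ)
    (P : Matrix (Fin n) (Fin p₀) ℝ) (Pp : Matrix (Fin p₀) (Fin n) ℝ)
    (hQ₁ : Q * Qp * Q = Q) (hQ₂ : Qp * Q * Qp = Qp)
    (hQ₃ : (Q * Qp)ᵀ = Q * Qp) (hQ₄ : (Qp * Q)ᵀ = Qp * Q)
    (hP₁ : P * Pp * P = P) (hP₂ : Pp * P * Pp = Pp)
    (hP₃ : (P * Pp)ᵀ = P * Pp) (hP₄ : (Pp * P)ᵀ = Pp * P)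
    (F : (Fin n → Fin m → ℝ) → ℝ) (hFmeas : Measurable F)
    (hFbdd : ∃ CF : ℝ, ∀ x, |F x| ≤ CF)
    (G : (Fin n → Fin q₀ → ℝ) × (Fin m → Fin p₀ → ℝ) → ℝ) (hGmeas : Measurable G)
    (hGbdd : ∃ CG : ℝ, ∀ x, |G x| ≤ CG) :
    ∫ ω, F (A ω) * G (Matrix.of (A ω) * Q, (Matrix.of (A ω))ᵀ * P)
      = ∫ ω, F
          ((Matrix.of (A ω) * Q) * Qp + Ppᵀ * (Matrix.of (A ω)ᵀ * P)ᵀ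
            - Ppᵀ * Pᵀ * (Matrix.of (A ω) * Q) * Qp
            + (1 - P * Pp) * Matrix.of (Atil ω) * (1 - Q * Qp))
          * G (Matrix.of (A ω) * Q, (Matrix.of (A ω))ᵀ * P) := by
  set U : Matrix (Fin n) (Fin n) ℝ := 1 - P * Pp with hU
  set V : Matrix (Fin m) (Fin m) ℝ := 1 - Q * Qp with hV
  have hUt : Uᵀ = U := by rw [hU, transpose_sub, transpose_one, hP₃]
  have hVt : Vᵀ = V := by rw [hV, transpose_sub, transpose_one, hQ₃]
  have hUP : U * P = 0 := by rw [hU, Matrix.sub_mul, Matrix.one_mul, hP₁, sub_self]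
  have hVQ : V * Q = 0 := by rw [hV, Matrix.sub_mul, Matrix.one_mul, hQ₁, sub_self]
  have hUU : U * U = U := by
    nth_rw 2 [hU]
    rw [mul_sub, mul_one, ← Matrix.mul_assoc, hUP, Matrix.zero_mul, sub_zero]
  have hVV : V * V = V := by
    nth_rw 2 [hV]
    rw [mul_sub, mul_one, ← Matrix.mul_assoc, hVQ, Matrix.zero_mul, sub_zero]
  have hPP : Ppᵀ * Pᵀ = P * Pp := by rw [← transpose_mul, hP₃]
  let R : (Fin n → Fin m → ℝ) → Fin n → Fin m → ℝ := fun x => U * of x * V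
  let S : (Fin n → Fin m → ℝ) → Fin n → Fin m → ℝ := fun x => of x - U * of x * V
  have hR : Measurable R := measurable_mul_of_mul U V
  have hS : Measurable S := measurable_id.sub hR
  have hSR : IndepFun (S ∘ A) (R ∘ A) volume :=
    indepFun_sub_mul_mul hAmeas hAlaw hUt hVt hUU hVV
  have hident : IdentDistrib (fun ω => (S (A ω), R (A ω))) (fun ω => (S (A ω), R (Atil ω)))
      volume volume :=
    IdentDistrib.prodMk (IdentDistrib.refl (hS.comp hAmeas).aemeasurable)
      ((⟨hAmeas.aemeasurable, hAtilmeas.aemeasurable, hAlaw.trans hAtillaw.symm⟩ :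
        IdentDistrib A Atil volume volume).comp hR)
      hSR (hindep.comp hS hR)
  let g : (Fin n → Fin m → ℝ) → (Fin n → Fin q₀ → ℝ) × (Fin m → Fin p₀ → ℝ) :=
    fun x => (of x * Q, (of x)ᵀ * P)
  have hg : Measurable g := by
    refine Measurable.prodMk ?_ ?_ <;>
    · refine measurable_pi_lambda _ fun i => measurable_pi_lambda _ fun j => ?_
      simp only [mul_apply, of_apply, transpose_apply]
      fun_prop
  have hgS (x : Fin n → Fin m → ℝ) : g (S x) = g x := by
    refine Prod.ext ?_ ?_
    · change (of x - U * of x * V) * Q = of x * Q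
      rw [Matrix.sub_mul, Matrix.mul_assoc, hVQ, Matrix.mul_zero, sub_zero]
    · change (of x - U * of x * V)ᵀ * P = (of x)ᵀ * P
      rw [transpose_sub, transpose_mul, transpose_mul, hUt, Matrix.sub_mul, Matrix.mul_assoc,
        Matrix.mul_assoc, hUP, Matrix.mul_zero, Matrix.mul_zero, sub_zero]
  have hES (x : Fin n → Fin m → ℝ) :
      of x * Q * Qp + Ppᵀ * ((of x)ᵀ * P)ᵀ - Ppᵀ * Pᵀ * (of x * Q) * Qp
        = of x - U * of x * V := by
    rw [transpose_mul, transpose_transpose, ← Matrix.mul_assoc, hPP, hU, hV]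
    simp only [Matrix.sub_mul, Matrix.mul_sub, Matrix.one_mul, Matrix.mul_one, Matrix.mul_assoc]
    abel
  have hint := (hident.comp (u := fun z : (Fin n → Fin m → ℝ) × (Fin n → Fin m → ℝ) =>
    F (z.1 + z.2) * G (g z.1))
    ((hFmeas.comp (measurable_fst.add measurable_snd)).mul
      (hGmeas.comp (hg.comp measurable_fst)))).integral_eq
  convert hint using 2
  · funext ω
    change _ = F (S (A ω) + R (A ω)) * G (g (S (A ω)))
    rw [hgS, show S (A ω) + R (A ω) = A ω from sub_add_cancel (A ω) (R (A ω))]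
  · funext ω
    change _ = F (S (A ω) + R (Atil ω)) * G (g (S (A ω)))
    rw [hgS]
    exact congrArg (fun z => F (z + U * of (Atil ω) * V) * G (g (A ω))) (hES (A ω))
end

section
/- Let z ~ N(0, Π) where Π ∈ R^{n×n} is a positive semidefinite matrix with strictly positive diagonal entries, and suppose the correlation matrix C = D^{-1/2} Π D^{-1/2} with D = Diag(Π) satisfies Σ_{i<j} C_{ij}² ≤ R for some constant R. Let p ≥ 6 be an integer and L > 1. For each i ∈ [n], let φ_i: R → R be a function with mean μ_i = E_{x~N(0,Π_{ii})}[φ_i(x)] and finite centered moments of order 2pL under x ~ N(0, Π_{ii}). Define Q = (1/n) Σ_{i=1}^n φ_i(z_i). Then E[(Q − E[Q])^{2p}] ≤ 𝒞 · n^{-1.5 + 1/L} · ((1/n) Σ_{i=1}^n E_{x~N(0,Π_{ii})}[(φ_i(x) − μ_i)^{2pL}])^{1/L}, where 𝒞 is a constant depending only on p and R (not on n or on the functions φ_i). -/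
set_option autoImplicit false

open MeasureTheory ProbabilityTheory Matrix Filter

/-- The standard Gaussian measure on `ι → ℝ`. -/
noncomputable abbrev piGaussian (ι : Type*) [Fintype ι] : Measure (ι → ℝ) :=
  Measure.pi fun _ : ι => gaussianReal 0 1

theorem charFun_map_mulVec_piGaussian {ι κ : Type*} [Fintype ι] [Fintype κ]
    (B : Matrix ι κ ℝ) (t : EuclideanSpace ℝ ι) :
    charFun ((piGaussian κ).map fun x => WithLp.toLp 2 (B.mulVec x)) t
      = Complex.exp (((-(t.ofLp ⬝ᵥ (B * Bᵀ) *ᵥ t.ofLp) / 2 : ℝ)) : ℂ) := by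
  have hm : Measurable fun x : κ → ℝ => WithLp.toLp 2 (B.mulVec x) :=
    (PiLp.continuous_toLp 2 _).measurable.comp
      (Continuous.measurable (by fun_prop))
  have h1 : charFun ((piGaussian κ).map fun x => WithLp.toLp 2 (B.mulVec x)) t
      = charFun ((piGaussian κ).map (WithLp.toLp 2)) (WithLp.toLp 2 (Bᵀ.mulVec t.ofLp)) := by
    rw [charFun_apply, charFun_apply, integral_map hm.aemeasurable (by fun_prop),
      integral_map (by fun_prop) (by fun_prop)]
    congr 1 with x
    congr 3
    simp only [EuclideanSpace.inner_eq_star_dotProduct, star_trivial]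
    rw [Matrix.dotProduct_mulVec, Matrix.mulVec_transpose]
  rw [h1, charFun_pi]
  simp_rw [charFun_gaussianReal]
  rw [← Complex.exp_sum]
  congr 1
  have h2 : t.ofLp ⬝ᵥ (B * Bᵀ) *ᵥ t.ofLp = ∑ j, (Bᵀ *ᵥ t.ofLp) j ^ 2 := by
    rw [← Matrix.mulVec_mulVec, Matrix.dotProduct_mulVec, ← Matrix.mulVec_transpose]
    simp [dotProduct, sq]
  rw [h2]
  push_cast
  rw [← Finset.sum_neg_distrib, Finset.sum_div]
  exact Finset.sum_congr rfl fun i _ => by simp; ring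

theorem map_mulVec_piGaussian_congr {ι κ κ' : Type*} [Fintype ι] [Fintype κ] [Fintype κ']
    (B : Matrix ι κ ℝ) (B' : Matrix ι κ' ℝ) (h : B * Bᵀ = B' * B'ᵀ) :
    (piGaussian κ).map B.mulVec = (piGaussian κ').map B'.mulVec := by
  have hm : Measurable B.mulVec := Continuous.measurable (by fun_prop)
  have hm' : Measurable B'.mulVec := Continuous.measurable (by fun_prop)
  have hL : Measurable (WithLp.toLp 2 : (ι → ℝ) → EuclideanSpace ℝ ι) :=
    (PiLp.continuous_toLp 2 _).measurable
  have hO : Measurable (WithLp.ofLp : EuclideanSpace ℝ ι → (ι → ℝ)) :=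
    (PiLp.continuous_ofLp 2 _).measurable
  have key : (piGaussian κ).map (fun x => WithLp.toLp 2 (B.mulVec x))
      = (piGaussian κ').map (fun x => WithLp.toLp 2 (B'.mulVec x)) := by
    have := Measure.isProbabilityMeasure_map (μ := piGaussian κ) (hL.comp hm).aemeasurable
    have := Measure.isProbabilityMeasure_map (μ := piGaussian κ') (hL.comp hm').aemeasurable
    apply Measure.ext_of_charFun (E := EuclideanSpace ℝ ι)
    ext t
    rw [charFun_map_mulVec_piGaussian, charFun_map_mulVec_piGaussian, h]
  have h2 := congrArg (Measure.map (WithLp.ofLp : EuclideanSpace ℝ ι → (ι → ℝ))) key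
  have e := Measure.map_map (μ := piGaussian κ) hO (hL.comp hm)
  have e' := Measure.map_map (μ := piGaussian κ') hO (hL.comp hm')
  exact e.symm.trans (h2.trans e')

theorem map_mulVec_apply_piGaussian {ι κ : Type*} [Fintype ι] [Fintype κ]
    (B : Matrix ι κ ℝ) (i : ι) :
    (piGaussian κ).map (fun x => B.mulVec x i)
      = (gaussianReal 0 1).map (fun y => Real.sqrt ((B * Bᵀ) i i) * y) := by
  set b := Real.sqrt ((B * Bᵀ) i i) with hb
  have hnn : 0 ≤ (B * Bᵀ) i i := by
    simp only [Matrix.mul_apply, Matrix.transpose_apply]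
    exact Finset.sum_nonneg fun j _ => mul_self_nonneg _
  let B₁ : Matrix Unit κ ℝ := fun _ j => B i j
  let B₂ : Matrix Unit Unit ℝ := fun _ _ => b
  have h : B₁ * B₁ᵀ = B₂ * B₂ᵀ := by
    ext u v
    have : (B₂ * B₂ᵀ) u v = b * b := by
      change ∑ _ : Unit, b * b = b * b
      simp
    rw [this, hb, Real.mul_self_sqrt hnn]
    rw [Matrix.mul_apply, Matrix.mul_apply]
    rfl
  have h1 := congrArg (Measure.map (fun y : Unit → ℝ => y ()))
    (map_mulVec_piGaussian_congr B₁ B₂ h)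
  have hm : Measurable B₁.mulVec := Continuous.measurable (by fun_prop)
  have hm' : Measurable B₂.mulVec := Continuous.measurable (by fun_prop)
  have hev : Measurable fun y : Unit → ℝ => y () := measurable_pi_apply ()
  rw [Measure.map_map hev hm, Measure.map_map hev hm'] at h1
  have h2 : (fun y : Unit → ℝ => y ()) ∘ B₂.mulVec
      = (fun y => b * y) ∘ (fun x : Unit → ℝ => x ()) := by
    ext x
    simp [Matrix.mulVec, dotProduct, B₂]
  have h3 : (piGaussian Unit).map (fun x : Unit → ℝ => x ()) = gaussianReal 0 1 :=
    (measurePreserving_eval (fun _ : Unit => gaussianReal 0 1) ()).map_eq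
  rw [h2, ← Measure.map_map (by fun_prop) hev, h3] at h1
  exact h1

theorem piGaussian_eq_withDensity (ι : Type*) [Fintype ι] :
    piGaussian ι = (volume : Measure (ι → ℝ)).withDensity
      fun x => ENNReal.ofReal (∏ i, gaussianPDFReal 0 1 (x i)) := by
  refine Measure.pi_eq fun s hs => ?_
  rw [withDensity_apply _ (MeasurableSet.univ_pi hs), volume_pi, Measure.restrict_pi_pi,
    ← ofReal_integral_eq_lintegral_ofReal]
  · rw [integral_fintype_prod_eq_prod (fun _ => gaussianPDFReal 0 1),
      ENNReal.ofReal_prod_of_nonneg]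
    · exact Finset.prod_congr rfl fun i _ =>
        (gaussianReal_apply_eq_integral 0 one_ne_zero (s i)).symm
    · exact fun i _ => integral_nonneg fun x => gaussianPDFReal_nonneg 0 1 x
  · exact Integrable.fintype_prod fun i => (integrable_gaussianPDFReal 0 1).restrict
  · exact ae_of_all _ fun x => Finset.prod_nonneg fun i _ => gaussianPDFReal_nonneg 0 1 _

theorem integral_piGaussian {ι : Type*} [Fintype ι] (F : (ι → ℝ) → ℝ) :
    ∫ x, F x ∂(piGaussian ι) = ∫ x, (∏ i, gaussianPDFReal 0 1 (x i)) * F x := by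
  rw [piGaussian_eq_withDensity, integral_withDensity_eq_integral_toReal_smul]
  · refine integral_congr_ae (ae_of_all _ fun x => ?_)
    simp only [smul_eq_mul]
    rw [ENNReal.toReal_ofReal (Finset.prod_nonneg fun i _ => gaussianPDFReal_nonneg 0 1 _)]
  · exact (Finset.measurable_prod _ fun i _ =>
      (measurable_gaussianPDFReal 0 1).comp (measurable_pi_apply i)).ennreal_ofReal
  · exact ae_of_all _ fun x => ENNReal.ofReal_lt_top

theorem prod_gaussianPDFReal_std {ι : Type*} [Fintype ι] (x : ι → ℝ) :
    ∏ i, gaussianPDFReal 0 1 (x i)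
      = (Real.sqrt (2 * Real.pi))⁻¹ ^ Fintype.card ι * Real.exp (-(x ⬝ᵥ x) / 2) := by
  simp only [gaussianPDFReal, Finset.prod_mul_distrib, ← Real.exp_sum]
  simp [Finset.card_univ, dotProduct, sq, Finset.sum_div, neg_div]

/-- Change of variables for the standard Gaussian under an invertible matrix. -/
theorem integral_piGaussian_comp_mulVec {ι : Type*} [Fintype ι] [DecidableEq ι]
    (T : Matrix ι ι ℝ) (hT : T.det ≠ 0) (F : (ι → ℝ) → ℝ) :
    ∫ x, F (T *ᵥ x) ∂(piGaussian ι)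
      = |T.det|⁻¹ * ∫ y, F y * Real.exp (((y ⬝ᵥ y) - (T⁻¹ *ᵥ y) ⬝ᵥ (T⁻¹ *ᵥ y)) / 2)
          ∂(piGaussian ι) := by
  have hU : IsUnit T.det := hT.isUnit
  let G : (ι → ℝ) → ℝ := fun y => (∏ i, gaussianPDFReal 0 1 ((T⁻¹ *ᵥ y) i)) * F y
  have hemb : MeasurableEmbedding (Matrix.toLin' T) := by
    have h1 : Function.Injective (Matrix.toLin' T) := by
      intro x y h
      simp only [Matrix.toLin'_apply] at h
      exact Matrix.mulVec_injective_iff_isUnit.2 ((Matrix.isUnit_iff_isUnit_det _).2 hU) h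
    exact (LinearMap.isClosedEmbedding_of_injective (LinearMap.ker_eq_bot.2 h1)).measurableEmbedding
  have h1 : ∫ x, (∏ i, gaussianPDFReal 0 1 (x i)) * F (T *ᵥ x) = ∫ x, G (Matrix.toLin' T x) := by
    congr 1 with x
    simp [G, Matrix.mulVec_mulVec, Matrix.nonsing_inv_mul _ hU]
  rw [integral_piGaussian, h1, ← hemb.integral_map, Real.map_matrix_volume_pi_eq_smul_volume_pi hT,
    integral_smul_measure, integral_piGaussian, ENNReal.toReal_ofReal (abs_nonneg _), abs_inv,
    smul_eq_mul]
  congr 2 with y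
  simp only [G, prod_gaussianPDFReal_std]
  rw [show (((y ⬝ᵥ y) - (T⁻¹ *ᵥ y) ⬝ᵥ (T⁻¹ *ᵥ y)) / 2)
    = y ⬝ᵥ y / 2 + (-((T⁻¹ *ᵥ y) ⬝ᵥ (T⁻¹ *ᵥ y)) / 2) by ring, Real.exp_add,
    show (-(y ⬝ᵥ y) / 2) = -(y ⬝ᵥ y / 2) by ring, Real.exp_neg (y ⬝ᵥ y / 2)]
  field_simp

theorem sq_dotProduct_le {ι : Type*} [Fintype ι] (u v : ι → ℝ) :
    (u ⬝ᵥ v) ^ 2 ≤ (u ⬝ᵥ u) * (v ⬝ᵥ v) := by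
  have := Finset.sum_mul_sq_le_sq_mul_sq Finset.univ u v
  simpa [dotProduct, sq] using this

theorem dotProduct_self_nonneg' {ι : Type*} [Fintype ι] (u : ι → ℝ) : 0 ≤ u ⬝ᵥ u :=
  Finset.sum_nonneg fun i _ => mul_self_nonneg (u i)

theorem mulVec_dotProduct_self_le {ι : Type*} [Fintype ι] (A : Matrix ι ι ℝ) (a : ℝ)
    (hA : ∑ i, ∑ j, A i j ^ 2 ≤ a ^ 2) (v : ι → ℝ) :
    (A *ᵥ v) ⬝ᵥ (A *ᵥ v) ≤ a ^ 2 * (v ⬝ᵥ v) := by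
  calc (A *ᵥ v) ⬝ᵥ (A *ᵥ v) = ∑ i, (A i ⬝ᵥ v) ^ 2 := by simp [dotProduct, Matrix.mulVec, sq]
    _ ≤ ∑ i, (A i ⬝ᵥ A i) * (v ⬝ᵥ v) := Finset.sum_le_sum fun i _ => sq_dotProduct_le _ _
    _ = (∑ i, ∑ j, A i j ^ 2) * (v ⬝ᵥ v) := by
        rw [← Finset.sum_mul]; simp [dotProduct, sq]
    _ ≤ _ := mul_le_mul_of_nonneg_right hA (dotProduct_self_nonneg' v)

theorem abs_dotProduct_mulVec_le {ι : Type*} [Fintype ι] (A : Matrix ι ι ℝ) (a : ℝ) (ha : 0 ≤ a)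
    (hA : ∑ i, ∑ j, A i j ^ 2 ≤ a ^ 2) (v : ι → ℝ) :
    |v ⬝ᵥ A *ᵥ v| ≤ a * (v ⬝ᵥ v) := by
  have h0 := dotProduct_self_nonneg' v
  apply abs_le_of_sq_le_sq _ (mul_nonneg ha h0)
  have := sq_dotProduct_le v (A *ᵥ v)
  have := mul_le_mul_of_nonneg_left (mulVec_dotProduct_self_le A a hA v) h0
  nlinarith

theorem det_one_add_ne_zero {ι : Type*} [Fintype ι] [DecidableEq ι] (A : Matrix ι ι ℝ) (a : ℝ)
    (ha : 0 ≤ a) (ha1 : a < 1) (hA : ∑ i, ∑ j, A i j ^ 2 ≤ a ^ 2) : (1 + A).det ≠ 0 := by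
  intro h
  obtain ⟨v, hv, hv0⟩ := Matrix.exists_mulVec_eq_zero_iff.2 h
  rw [Matrix.add_mulVec, Matrix.one_mulVec] at hv0
  have h1 : A *ᵥ v = -v := by rw [← sub_eq_zero, sub_neg_eq_add, add_comm]; exact hv0
  have h2 := mulVec_dotProduct_self_le A a hA v
  rw [h1, neg_dotProduct_neg] at h2
  have h3 : v ⬝ᵥ v ≠ 0 := fun h => hv (dotProduct_self_eq_zero.1 h)
  have h4 : 0 < v ⬝ᵥ v := lt_of_le_of_ne (dotProduct_self_nonneg' v) (Ne.symm h3)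
  nlinarith [mul_pos (show 0 < 1 - a ^ 2 by nlinarith) h4]

theorem abs_quadratic_inv_sub_le {ι : Type*} [Fintype ι] [DecidableEq ι] (A : Matrix ι ι ℝ)
    (hsymm : Aᵀ = A) (a : ℝ) (ha : 0 ≤ a) (ha1 : a ≤ 1 / 2) (hA : ∑ i, ∑ j, A i j ^ 2 ≤ a ^ 2)
    (y : ι → ℝ) :
    |y ⬝ᵥ y - y ⬝ᵥ (1 + A)⁻¹ *ᵥ y - y ⬝ᵥ A *ᵥ y| ≤ 2 * a ^ 2 * (y ⬝ᵥ y) := by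
  have hU : IsUnit (1 + A).det := (det_one_add_ne_zero A a ha (by linarith) hA).isUnit
  obtain ⟨w, hw⟩ : ∃ w, w = (1 + A)⁻¹ *ᵥ y := ⟨_, rfl⟩
  have hy : y = w + A *ᵥ w := by
    have e : w + A *ᵥ w = (1 + A) *ᵥ w := by rw [Matrix.add_mulVec, Matrix.one_mulVec]
    rw [e, hw, Matrix.mulVec_mulVec, Matrix.mul_nonsing_inv _ hU, Matrix.one_mulVec]
  rw [← hw]
  have hA2 : y ⬝ᵥ y - y ⬝ᵥ w - y ⬝ᵥ A *ᵥ y = -((A *ᵥ y) ⬝ᵥ (A *ᵥ w)) := by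
    have e1 : y ⬝ᵥ y = y ⬝ᵥ w + y ⬝ᵥ A *ᵥ w := by
      conv_lhs => rw [show y ⬝ᵥ y = y ⬝ᵥ (w + A *ᵥ w) by rw [← hy]]
      rw [dotProduct_add]
    have e2 : y ⬝ᵥ A *ᵥ y = y ⬝ᵥ A *ᵥ w + y ⬝ᵥ A *ᵥ (A *ᵥ w) := by
      conv_lhs => rw [show A *ᵥ y = A *ᵥ (w + A *ᵥ w) by rw [← hy]]
      rw [Matrix.mulVec_add, dotProduct_add]
    have e3 : y ⬝ᵥ A *ᵥ (A *ᵥ w) = (A *ᵥ y) ⬝ᵥ (A *ᵥ w) := by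
      rw [Matrix.dotProduct_mulVec, ← Matrix.mulVec_transpose, hsymm]
    rw [e2, ← e3, e1]; ring
  have hyy := dotProduct_self_nonneg' y
  have hww := dotProduct_self_nonneg' w
  have hAw := mulVec_dotProduct_self_le A a hA w
  have hAy := mulVec_dotProduct_self_le A a hA y
  have hw4 : w ⬝ᵥ w ≤ 4 * (y ⬝ᵥ y) := by
    have e : w ⬝ᵥ w + 2 * (w ⬝ᵥ A *ᵥ w) + (A *ᵥ w) ⬝ᵥ (A *ᵥ w) = y ⬝ᵥ y := by
      conv_rhs => rw [hy]
      rw [dotProduct_add, add_dotProduct, add_dotProduct, dotProduct_comm (A *ᵥ w) w]; ring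
    have h2 : 0 ≤ (w + (2 : ℝ) • A *ᵥ w) ⬝ᵥ (w + (2 : ℝ) • A *ᵥ w) := dotProduct_self_nonneg' _
    have h3 : (w + (2 : ℝ) • A *ᵥ w) ⬝ᵥ (w + (2 : ℝ) • A *ᵥ w)
        = w ⬝ᵥ w + 4 * (w ⬝ᵥ A *ᵥ w) + 4 * ((A *ᵥ w) ⬝ᵥ (A *ᵥ w)) := by
      simp only [dotProduct_add, add_dotProduct, dotProduct_comm (A *ᵥ w) w, dotProduct_smul,
        smul_dotProduct, smul_eq_mul]
      ring
    nlinarith [mul_le_mul_of_nonneg_right (show a ^ 2 ≤ 1 / 4 by nlinarith) hww]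
  rw [hA2, abs_neg]
  apply abs_le_of_sq_le_sq _ (by positivity)
  calc ((A *ᵥ y) ⬝ᵥ (A *ᵥ w)) ^ 2 ≤ _ := sq_dotProduct_le _ _
    _ ≤ (a ^ 2 * (y ⬝ᵥ y)) * (a ^ 2 * (4 * (y ⬝ᵥ y))) := by
        apply mul_le_mul hAy (hAw.trans (by gcongr)) (dotProduct_self_nonneg' _) (by positivity)
    _ = _ := by ring

theorem integrable_exp_mul_sq_gaussianReal {b : ℝ} (hb : b < 1 / 2) :
    Integrable (fun x : ℝ => Real.exp (b * x ^ 2)) (gaussianReal 0 1) := by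
  rw [gaussianReal_of_var_ne_zero _ one_ne_zero,
    integrable_withDensity_iff_integrable_smul₀' (by fun_prop)
      (ae_of_all _ fun x => gaussianPDF_lt_top)]
  refine ((integrable_exp_neg_mul_sq (sub_pos.2 hb)).const_mul
    (Real.sqrt (2 * Real.pi))⁻¹).congr (ae_of_all _ fun x => ?_)
  simp only [toReal_gaussianPDF, gaussianPDFReal, smul_eq_mul, NNReal.coe_one, mul_one, sub_zero]
  rw [mul_assoc, ← Real.exp_add]
  ring_nf

theorem sq_le_mul_exp {s : ℝ} (hs : 0 ≤ s) : s ^ 2 ≤ 512 * Real.exp (s / 16) := by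
  have := Real.quadratic_le_exp_of_nonneg (show 0 ≤ s / 16 by positivity)
  nlinarith

theorem le_mul_exp {s : ℝ} : s ≤ 8 * Real.exp (s / 8) := by
  have := Real.add_one_le_exp (s / 8)
  linarith

/-- The second order expansion of `exp u` when `u` is `b / 2` up to second order errors. -/
theorem abs_exp_sub_one_sub_le {a s u b : ℝ} (ha : 0 ≤ a) (ha1 : a ≤ 1 / 16) (hs : 0 ≤ s)
    (hb : |b| ≤ a * s) (hu : |2 * u - b| ≤ 2 * a ^ 2 * s) :
    |u| ≤ s / 16 ∧ |Real.exp u - 1 - b / 2| ≤ 520 * a ^ 2 * Real.exp (s / 8) := by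
  have has : 0 ≤ a * s := by positivity
  have hu1 : |u| ≤ a * s := by
    rw [abs_le] at *
    constructor <;> nlinarith
  have hu2 : |u| ≤ s / 16 := hu1.trans (by nlinarith)
  refine ⟨hu2, ?_⟩
  have h1 : |Real.exp u - 1 - u| ≤ |u| ^ 2 * Real.exp |u| := by
    have := Complex.norm_exp_sub_sum_le_norm_mul_exp (u : ℂ) 2
    simp only [Finset.sum_range_succ, Finset.sum_range_zero, pow_zero, Nat.factorial, Nat.cast_one,
      div_one, zero_add, pow_one, mul_one] at this
    have e : (Complex.exp u - (1 + (u : ℂ))) = ((Real.exp u - 1 - u : ℝ) : ℂ) := by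
      push_cast; ring
    rw [e, Complex.norm_real, Complex.norm_real] at this
    exact this
  have h2 : |u| ^ 2 * Real.exp |u| ≤ 512 * a ^ 2 * Real.exp (s / 8) := by
    calc |u| ^ 2 * Real.exp |u| ≤ (a * s) ^ 2 * Real.exp (s / 16) := by gcongr
      _ = a ^ 2 * s ^ 2 * Real.exp (s / 16) := by ring
      _ ≤ a ^ 2 * (512 * Real.exp (s / 16)) * Real.exp (s / 16) := by
          gcongr; exact sq_le_mul_exp hs
      _ = 512 * a ^ 2 * (Real.exp (s / 16) * Real.exp (s / 16)) := by ring
      _ = _ := by rw [← Real.exp_add]; ring_nf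
  have h3 : |u - b / 2| ≤ 8 * a ^ 2 * Real.exp (s / 8) := by
    calc |u - b / 2| = |2 * u - b| / 2 := by
          rw [show u - b / 2 = (2 * u - b) / 2 by ring, abs_div, abs_two]
      _ ≤ a ^ 2 * s := by linarith
      _ ≤ a ^ 2 * (8 * Real.exp (s / 8)) := by gcongr; exact le_mul_exp
      _ = _ := by ring
  calc |Real.exp u - 1 - b / 2| = |(Real.exp u - 1 - u) + (u - b / 2)| := by ring_nf
    _ ≤ _ := abs_add_le _ _
    _ ≤ 512 * a ^ 2 * Real.exp (s / 8) + 8 * a ^ 2 * Real.exp (s / 8) := by linarith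
    _ = _ := by ring

theorem exists_square_factor {ι κ : Type*} [Fintype ι] [DecidableEq ι] [Fintype κ]
    (B : Matrix ι κ ℝ) : ∃ T : Matrix ι ι ℝ, T * Tᵀ = B * Bᵀ := by
  have hS : (B * Bᵀ).PosSemidef := by
    have := Matrix.posSemidef_self_mul_conjTranspose B
    rwa [Matrix.conjTranspose_eq_transpose_of_trivial] at this
  open scoped MatrixOrder in
  obtain ⟨X, hX⟩ := CStarAlgebra.nonneg_iff_eq_mul_star_self.1 hS.nonneg
  refine ⟨X, ?_⟩
  rw [hX, Matrix.star_eq_conjTranspose, Matrix.conjTranspose_eq_transpose_of_trivial]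

theorem integral_abs_mul_exp_le (f : ℝ → ℝ) (hf : Measurable f)
    (hf2 : Integrable (fun x => f x ^ 2) (gaussianReal 0 1)) :
    Integrable (fun x => |f x| * Real.exp (1 / 8 * x ^ 2)) (gaussianReal 0 1) ∧
      ∫ x, |f x| * Real.exp (1 / 8 * x ^ 2) ∂(gaussianReal 0 1)
        ≤ Real.sqrt (∫ x, Real.exp (1 / 4 * x ^ 2) ∂(gaussianReal 0 1))
          * Real.sqrt (∫ x, f x ^ 2 ∂(gaussianReal 0 1)) := by
  have hf' : MemLp (fun x => |f x|) 2 (gaussianReal 0 1) := by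
    rw [memLp_two_iff_integrable_sq (by fun_prop)]
    simpa only [sq_abs] using hf2
  have he2 : ∀ x : ℝ, Real.exp (1 / 8 * x ^ 2) ^ 2 = Real.exp (1 / 4 * x ^ 2) := fun x => by
    rw [← Real.exp_nat_mul]; push_cast; ring_nf
  have he : MemLp (fun x : ℝ => Real.exp (1 / 8 * x ^ 2)) 2 (gaussianReal 0 1) := by
    rw [memLp_two_iff_integrable_sq (by fun_prop)]
    simp only [he2]
    exact integrable_exp_mul_sq_gaussianReal (by norm_num)
  refine ⟨MemLp.integrable_mul hf' he, ?_⟩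
  have := integral_mul_le_Lp_mul_Lq_of_nonneg (μ := gaussianReal 0 1) Real.HolderConjugate.two_two
    (ae_of_all _ fun x => abs_nonneg (f x)) (ae_of_all _ fun x => (Real.exp_pos _).le)
    (by rwa [ENNReal.ofReal_ofNat]) (by rwa [ENNReal.ofReal_ofNat])
  refine this.trans (le_of_eq ?_)
  simp only [Real.rpow_two, sq_abs, he2, ← Real.sqrt_eq_rpow]
  rw [mul_comm]

/-- A product of functions of weakly correlated standard Gaussians, sufficiently many of which are
centered, has an expectation which is quadratically small in the correlations. -/
theorem exists_abs_integral_prod_le : ∃ K₁ : ℝ, 1 ≤ K₁ ∧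
    ∀ {ι κ : Type} [Fintype ι] [DecidableEq ι] [Nonempty ι] [Fintype κ] (B : Matrix ι κ ℝ),
    (∀ i, (B * Bᵀ) i i = 1) → ∀ (a : ℝ), 0 ≤ a → a ≤ 1 / 16 →
    ∑ i, ∑ j, (if i = j then 0 else (B * Bᵀ) i j) ^ 2 ≤ a ^ 2 →
    ∀ f : ι → ℝ → ℝ, (∀ i, Measurable (f i)) →
    (∀ i, Integrable (fun x => f i x ^ 2) (gaussianReal 0 1)) →
    (∀ i j, ∃ l, l ≠ i ∧ l ≠ j ∧ ∫ x, f l x ∂(gaussianReal 0 1) = 0) →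
    |∫ x, ∏ i, f i ((B *ᵥ x) i) ∂(piGaussian κ)|
      ≤ 520 * K₁ ^ Fintype.card ι * a ^ 2
        * ∏ i, Real.sqrt (∫ x, f i x ^ 2 ∂(gaussianReal 0 1)) := by
  set κ₀ := ∫ x, Real.exp (-(1 / 16) * x ^ 2) ∂(gaussianReal 0 1) with hκ₀
  set H := Real.sqrt (∫ x, Real.exp (1 / 4 * x ^ 2) ∂(gaussianReal 0 1)) with hH
  have hint : ∀ {b : ℝ}, b < 1 / 2 →
      Integrable (fun x : ℝ => Real.exp (b * x ^ 2)) (gaussianReal 0 1) :=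
    integrable_exp_mul_sq_gaussianReal
  have hκpos : 0 < κ₀ := integral_exp_pos (hint (by norm_num))
  have hκ1 : κ₀ ≤ 1 := by
    calc κ₀ ≤ ∫ x : ℝ, (1 : ℝ) ∂(gaussianReal 0 1) :=
          integral_mono (hint (by norm_num)) (integrable_const _) fun x =>
            Real.exp_le_one_iff.2 (by nlinarith [sq_nonneg x])
      _ = 1 := by simp
  have hH1 : 1 ≤ H := by
    rw [hH, Real.one_le_sqrt]
    calc (1 : ℝ) = ∫ x : ℝ, (1 : ℝ) ∂(gaussianReal 0 1) := by simp
      _ ≤ _ := integral_mono (integrable_const _) (hint (by norm_num)) fun x =>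
            Real.one_le_exp (by positivity)
  refine ⟨H / κ₀, by rw [le_div_iff₀ hκpos]; linarith, ?_⟩
  intro ι κ _ _ _ _ B hdiag a ha ha1 hA f hf hf2 hcent
  obtain ⟨T, hT⟩ := exists_square_factor B
  set A : Matrix ι ι ℝ := fun i j => if i = j then 0 else (B * Bᵀ) i j with hAdef
  have hS : B * Bᵀ = 1 + A := by
    ext i j
    rw [Matrix.add_apply, hAdef]
    by_cases h : i = j
    · subst h; simp [hdiag]
    · simp [h]
  have hSsymm : (B * Bᵀ)ᵀ = B * Bᵀ := by simp [Matrix.transpose_mul]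
  have hAsymm : Aᵀ = A := by
    have : A = B * Bᵀ - 1 := by rw [hS]; abel
    rw [this, Matrix.transpose_sub, hSsymm, Matrix.transpose_one]
  have hdetS := det_one_add_ne_zero A a ha (by linarith) hA
  have hTdet : T.det ≠ 0 := by
    intro h
    rw [← hS, ← hT, Matrix.det_mul, h, zero_mul] at hdetS
    exact hdetS rfl
  -- the log-density
  set u : (ι → ℝ) → ℝ := fun y => ((y ⬝ᵥ y) - (T⁻¹ *ᵥ y) ⬝ᵥ (T⁻¹ *ᵥ y)) / 2 with hu
  have hucont : Measurable u := Continuous.measurable (by fun_prop)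
  have hquad : ∀ y, (T⁻¹ *ᵥ y) ⬝ᵥ (T⁻¹ *ᵥ y) = y ⬝ᵥ (1 + A)⁻¹ *ᵥ y := by
    intro y
    rw [← hS, ← hT, Matrix.mul_inv_rev, ← Matrix.mulVec_mulVec,
      ← Matrix.transpose_nonsing_inv, Matrix.dotProduct_mulVec y, Matrix.vecMul_transpose]
  have hbound : ∀ y, |u y| ≤ (y ⬝ᵥ y) / 16 ∧
      |Real.exp (u y) - 1 - (y ⬝ᵥ A *ᵥ y) / 2| ≤ 520 * a ^ 2 * Real.exp ((y ⬝ᵥ y) / 8) := by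
    intro y
    apply abs_exp_sub_one_sub_le ha ha1 (dotProduct_self_nonneg' y)
      (abs_dotProduct_mulVec_le A a ha hA y)
    have := abs_quadratic_inv_sub_le A hAsymm a ha (by linarith) hA y
    rw [← hquad] at this
    simpa only [hu, mul_div_cancel₀ _ (two_ne_zero' ℝ)] using this
  have hexp : ∀ (b : ℝ) (y : ι → ℝ), Real.exp (b * (y ⬝ᵥ y)) = ∏ i, Real.exp (b * y i ^ 2) := by
    intro b y
    rw [← Real.exp_sum, dotProduct, Finset.mul_sum]
    simp only [sq]
  have hcv := integral_piGaussian_comp_mulVec T hTdet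
  set c := |T.det|⁻¹ with hc
  have hc0 : 0 ≤ c := inv_nonneg.2 (abs_nonneg _)
  -- the normalising constant
  have hcκ : c * κ₀ ^ Fintype.card ι ≤ 1 := by
    have h1 := hcv fun _ => 1
    simp only [one_mul, integral_const, probReal_univ, smul_eq_mul, mul_one] at h1
    rw [h1]
    apply mul_le_mul_of_nonneg_left _ hc0
    rw [hκ₀, ← integral_fintype_prod_eq_pow (fun x : ℝ => Real.exp (-(1 / 16) * x ^ 2))]
    apply integral_mono
    · exact Integrable.fintype_prod fun _ => hint (by norm_num)
    · apply Integrable.mono' (g := fun y : ι → ℝ => ∏ i, Real.exp (1 / 16 * y i ^ 2))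
        (Integrable.fintype_prod fun _ => hint (by norm_num)) (by fun_prop)
      refine ae_of_all _ fun y => ?_
      rw [Real.norm_of_nonneg (Real.exp_pos _).le, ← hexp]
      apply Real.exp_le_exp.2
      change u y ≤ _
      have := (abs_le.1 (hbound y).1).2
      linarith
    · intro y
      simp only
      rw [← hexp]
      apply Real.exp_le_exp.2
      change _ ≤ u y
      have := (abs_le.1 (hbound y).1).1
      linarith
  set F : (ι → ℝ) → ℝ := fun y => ∏ i, f i (y i) with hF
  have hFm : Measurable F := Finset.measurable_prod _ fun i _ => (hf i).comp (measurable_pi_apply i)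
  have hlaw : ∫ x, F (B *ᵥ x) ∂(piGaussian κ) = c * ∫ y, F y * Real.exp (u y) ∂(piGaussian ι) := by
    rw [← hcv F, ← integral_map (φ := B.mulVec) (Continuous.measurable (by fun_prop)).aemeasurable
        hFm.aestronglyMeasurable,
      ← integral_map (φ := T.mulVec) (Continuous.measurable (by fun_prop)).aemeasurable
        hFm.aestronglyMeasurable, map_mulVec_piGaussian_congr B T hT.symm]
  set G : (ι → ℝ) → ℝ := fun y => ∏ i, (|f i (y i)| * Real.exp (1 / 8 * y i ^ 2)) with hG
  have hGF : ∀ y, G y = |F y| * Real.exp ((y ⬝ᵥ y) / 8) := by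
    intro y
    rw [hG, hF]
    simp only
    rw [Finset.prod_mul_distrib, ← hexp, Finset.abs_prod]
    ring_nf
  have hGint : Integrable G (piGaussian ι) :=
    Integrable.fintype_prod fun i => (integral_abs_mul_exp_le (f i) (hf i) (hf2 i)).1
  have hdom : ∀ (q : (ι → ℝ) → ℝ) (M : ℝ), Measurable q →
      (∀ y, |q y| ≤ M * Real.exp ((y ⬝ᵥ y) / 8)) →
      Integrable (fun y => F y * q y) (piGaussian ι) := by
    intro q M hq hqM
    refine (hGint.const_mul M).mono' (hFm.mul hq).aestronglyMeasurable (ae_of_all _ fun y => ?_)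
    rw [Real.norm_eq_abs, abs_mul, hGF]
    calc |F y| * |q y| ≤ |F y| * (M * Real.exp ((y ⬝ᵥ y) / 8)) := by gcongr; exact hqM y
      _ = _ := by ring
  have hone : ∀ y : ι → ℝ, 1 ≤ Real.exp ((y ⬝ᵥ y) / 8) := fun y =>
    Real.one_le_exp (by have := dotProduct_self_nonneg' y; positivity)
  have hcoord : ∀ (i j : ι) (y : ι → ℝ), |y i * y j| ≤ 8 * Real.exp ((y ⬝ᵥ y) / 8) := by
    intro i j y
    have h1 : ∀ i, y i ^ 2 ≤ y ⬝ᵥ y := fun i => by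
      rw [sq]
      exact Finset.single_le_sum (f := fun i => y i * y i) (fun i _ => mul_self_nonneg (y i))
        (Finset.mem_univ i)
    have h2 : |y i * y j| ≤ y ⬝ᵥ y := by
      rw [abs_mul]
      nlinarith [h1 i, h1 j, sq_abs (y i), sq_abs (y j), sq_nonneg (|y i| - |y j|)]
    exact h2.trans le_mul_exp
  have hzero : ∀ w : ι → ℝ → ℝ, (∃ l, (∀ x, w l x = 1) ∧ ∫ x, f l x ∂(gaussianReal 0 1) = 0) →
      ∫ y, F y * ∏ i, w i (y i) ∂(piGaussian ι) = 0 := by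
    rintro w ⟨l, hw, hl⟩
    simp only [hF, ← Finset.prod_mul_distrib]
    rw [integral_fintype_prod_eq_prod (fun i x => f i x * w i x)]
    exact Finset.prod_eq_zero (Finset.mem_univ l) (by simpa [hw] using hl)
  have hF0 : ∫ y, F y ∂(piGaussian ι) = 0 := by
    obtain ⟨i⟩ := ‹Nonempty ι›
    obtain ⟨l, -, -, hl⟩ := hcent i i
    simpa using hzero (fun _ _ => 1) ⟨l, fun _ => rfl, hl⟩
  have hFij : ∀ i j, ∫ y, F y * (y i * y j) ∂(piGaussian ι) = 0 := by
    intro i j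
    obtain ⟨l, hli, hlj, hl⟩ := hcent i j
    have := hzero (fun k x => (if k = i then x else 1) * (if k = j then x else 1))
      ⟨l, fun x => by simp [hli, hlj], hl⟩
    simp only [Finset.prod_mul_distrib, Finset.prod_ite_eq', Finset.mem_univ, if_true] at this
    exact this
  have hFA : ∫ y, F y * (y ⬝ᵥ A *ᵥ y) ∂(piGaussian ι) = 0 := by
    have e : ∀ y : ι → ℝ, F y * (y ⬝ᵥ A *ᵥ y) = ∑ i, ∑ j, A i j * (F y * (y i * y j)) := by
      intro y
      simp only [dotProduct, Matrix.mulVec, Finset.mul_sum]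
      exact Finset.sum_congr rfl fun i _ => Finset.sum_congr rfl fun j _ => by ring
    have hi : ∀ i j, Integrable (fun y => A i j * (F y * (y i * y j))) (piGaussian ι) :=
      fun i j => (hdom _ 8 (by fun_prop) (hcoord i j)).const_mul _
    simp only [e]
    rw [integral_finsetSum _ fun i _ => integrable_finsetSum _ fun j _ => hi i j]
    refine Finset.sum_eq_zero fun i _ => ?_
    rw [integral_finsetSum _ fun j _ => hi i j]
    refine Finset.sum_eq_zero fun j _ => ?_
    rw [integral_const_mul, hFij, mul_zero]
  have hFAint : Integrable (fun y => F y * (y ⬝ᵥ A *ᵥ y)) (piGaussian ι) :=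
    hdom _ (a * 8) (Continuous.measurable (by fun_prop)) fun y =>
      (abs_dotProduct_mulVec_le A a ha hA y).trans (by
        rw [mul_assoc]; exact mul_le_mul_of_nonneg_left le_mul_exp ha)
  have hFint : Integrable F (piGaussian ι) := by
    simpa using hdom (fun _ => 1) 1 measurable_const (fun y => by simpa using hone y)
  have hrem := hdom (fun y => Real.exp (u y) - 1 - (y ⬝ᵥ A *ᵥ y) / 2) (520 * a ^ 2)
    (((hucont.exp).sub_const 1).sub (Continuous.measurable (by fun_prop))) fun y => (hbound y).2
  have hsplit : ∫ y, F y * Real.exp (u y) ∂(piGaussian ι)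
      = ∫ y, F y * (Real.exp (u y) - 1 - (y ⬝ᵥ A *ᵥ y) / 2) ∂(piGaussian ι) := by
    have e : ∀ y, F y * Real.exp (u y) = F y * (Real.exp (u y) - 1 - (y ⬝ᵥ A *ᵥ y) / 2) +
        (F y + 1 / 2 * (F y * (y ⬝ᵥ A *ᵥ y))) := fun y => by ring
    have h2 : Integrable (fun y => F y + 1 / 2 * (F y * (y ⬝ᵥ A *ᵥ y))) (piGaussian ι) :=
      hFint.add (hFAint.const_mul _)
    simp only [e]
    rw [integral_add hrem h2,
      integral_add hFint (hFAint.const_mul _), integral_const_mul, hF0, hFA]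
    simp
  have hmain : |∫ y, F y * Real.exp (u y) ∂(piGaussian ι)|
      ≤ 520 * a ^ 2 * (H ^ Fintype.card ι
        * ∏ i, Real.sqrt (∫ x, f i x ^ 2 ∂(gaussianReal 0 1))) := by
    rw [hsplit]
    calc _ ≤ ∫ y, 520 * a ^ 2 * G y ∂(piGaussian ι) := by
          refine (abs_integral_le_integral_abs).trans (integral_mono hrem.abs
            (hGint.const_mul _) fun y => ?_)
          simp only
          rw [abs_mul, hGF]
          calc _ ≤ |F y| * (520 * a ^ 2 * Real.exp ((y ⬝ᵥ y) / 8)) := by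
                gcongr; exact (hbound y).2
            _ = _ := by ring
      _ = 520 * a ^ 2 * ∏ i, ∫ x, |f i x| * Real.exp (1 / 8 * x ^ 2) ∂(gaussianReal 0 1) := by
          rw [integral_const_mul, hG,
            integral_fintype_prod_eq_prod (fun i x => |f i x| * Real.exp (1 / 8 * x ^ 2))]
      _ ≤ 520 * a ^ 2 * ∏ i, (H * Real.sqrt (∫ x, f i x ^ 2 ∂(gaussianReal 0 1))) := by
          gcongr with i
          exact (integral_abs_mul_exp_le (f i) (hf i) (hf2 i)).2
      _ = _ := by rw [Finset.prod_mul_distrib, Finset.prod_const, Finset.card_univ]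
  change |∫ x, F (B *ᵥ x) ∂(piGaussian κ)| ≤ _
  rw [hlaw, abs_mul, abs_of_nonneg hc0]
  set P := ∏ i, Real.sqrt (∫ x, f i x ^ 2 ∂(gaussianReal 0 1))
  have hP : 0 ≤ P := Finset.prod_nonneg fun i _ => Real.sqrt_nonneg _
  have hcle : c ≤ (κ₀ ^ Fintype.card ι)⁻¹ := by
    rw [← one_div, le_div_iff₀ (by positivity)]; exact hcκ
  calc _ ≤ (κ₀ ^ Fintype.card ι)⁻¹ * (520 * a ^ 2 * (H ^ Fintype.card ι * P)) := by
        gcongr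
    _ = _ := by rw [div_pow]; field_simp

theorem pow_le_div_mul_pow_add {t : ℝ} (ht : 0 ≤ t) {k N : ℕ} (hk : k ≤ N) (hN : 0 < N) :
    t ^ k ≤ k / N * t ^ N + (1 - k / N) := by
  have hN' : (0 : ℝ) < N := by exact_mod_cast hN
  have hkN : (k : ℝ) / N ≤ 1 := by rw [div_le_one hN']; exact_mod_cast hk
  have h := Real.geom_mean_le_arith_mean2_weighted (w₁ := k / N) (w₂ := 1 - k / N) (p₁ := t ^ N)
    (p₂ := 1) (by positivity) (by linarith) (by positivity) zero_le_one (by ring)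
  rw [Real.one_rpow, mul_one, mul_one, ← Real.rpow_natCast t N, ← Real.rpow_mul ht,
    mul_div_cancel₀ _ hN'.ne', Real.rpow_natCast, Real.rpow_natCast] at h
  exact h

section Moments

variable {Ω : Type*} [MeasurableSpace Ω] {ν : Measure Ω}

theorem prod_abs_le_sum_pow {N : ℕ} (hN : 0 < N) (v : Fin N → ℝ) :
    ∏ j, |v j| ≤ ∑ j, (N : ℝ)⁻¹ * |v j| ^ N := by
  have hN' : (N : ℝ) ≠ 0 := by exact_mod_cast hN.ne'
  have := Real.geom_mean_le_arith_mean_weighted Finset.univ (fun _ : Fin N => (N : ℝ)⁻¹)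
    (fun j => |v j| ^ N) (fun _ _ => by positivity) (by simp [hN']) (fun _ _ => by positivity)
  simpa only [Real.pow_rpow_inv_natCast (abs_nonneg _) hN.ne'] using this

theorem integrable_prod_of_abs_pow {N : ℕ} (hN : 0 < N) {V : Fin N → Ω → ℝ}
    (hV : ∀ j, AEStronglyMeasurable (V j) ν) (hi : ∀ j, Integrable (fun x => |V j x| ^ N) ν) :
    Integrable (fun x => ∏ j, V j x) ν := by
  refine (integrable_finsetSum Finset.univ fun j _ => (hi j).const_mul (N : ℝ)⁻¹).mono'
    (Finset.aestronglyMeasurable_fun_prod _ fun j _ => hV j) (ae_of_all _ fun x => ?_)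
  rw [Real.norm_eq_abs, Finset.abs_prod]
  exact prod_abs_le_sum_pow hN fun j => V j x

theorem abs_integral_prod_le_of_abs_pow {N : ℕ} (hN : 0 < N) {V : Fin N → Ω → ℝ}
    (hV : ∀ j, AEStronglyMeasurable (V j) ν) (hi : ∀ j, Integrable (fun x => |V j x| ^ N) ν)
    {M : ℝ} (hM : ∀ j, ∫ x, |V j x| ^ N ∂ν ≤ M) :
    |∫ x, ∏ j, V j x ∂ν| ≤ M := by
  have hN' : (N : ℝ) ≠ 0 := by exact_mod_cast hN.ne'
  calc |∫ x, ∏ j, V j x ∂ν| ≤ ∫ x, ∑ j, (N : ℝ)⁻¹ * |V j x| ^ N ∂ν := by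
        refine abs_integral_le_integral_abs.trans (integral_mono
          (integrable_prod_of_abs_pow hN hV hi).abs
          (integrable_finsetSum _ fun j _ => (hi j).const_mul _) fun x => ?_)
        simp only [Finset.abs_prod]
        exact prod_abs_le_sum_pow hN fun j => V j x
    _ = ∑ j, (N : ℝ)⁻¹ * ∫ x, |V j x| ^ N ∂ν := by
        rw [integral_finsetSum _ fun j _ => (hi j).const_mul _]
        simp only [integral_const_mul]
    _ ≤ ∑ _j : Fin N, (N : ℝ)⁻¹ * M := by gcongr with j; exact hM j
    _ = M := by simp [hN']

variable [IsProbabilityMeasure ν]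

theorem integrable_abs_pow_of_le {f : Ω → ℝ} (hf : AEStronglyMeasurable f ν) {k N : ℕ}
    (hk : k ≤ N) (hN : 0 < N) (hi : Integrable (fun x => |f x| ^ N) ν) :
    Integrable (fun x => |f x| ^ k) ν := by
  refine ((hi.const_mul (k / N : ℝ)).add (integrable_const (1 - k / N : ℝ))).mono'
    (hf.norm.pow k) (ae_of_all _ fun x => ?_)
  rw [Real.norm_of_nonneg (by positivity)]
  exact pow_le_div_mul_pow_add (abs_nonneg _) hk hN

theorem integral_abs_pow_le_of_le {f : Ω → ℝ} {k N : ℕ} (hk : k ≤ N) (hN : 0 < N)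
    (hf : AEStronglyMeasurable f ν) (hi : Integrable (fun x => |f x| ^ N) ν)
    {c : ℝ} (hc : 0 ≤ c) (h : ∫ x, |f x| ^ N ∂ν ≤ c ^ N) :
    ∫ x, |f x| ^ k ∂ν ≤ c ^ k := by
  have main : ∀ c : ℝ, 0 < c → ∫ x, |f x| ^ N ∂ν ≤ c ^ N → ∫ x, |f x| ^ k ∂ν ≤ c ^ k := by
    intro c hc h
    have hpt : ∀ x, |f x| ^ k ≤ c ^ k * (k / N * ((c ^ N)⁻¹ * |f x| ^ N) + (1 - k / N)) := by
      intro x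
      have := pow_le_div_mul_pow_add (t := |f x| / c) (by positivity) hk hN
      rw [div_pow, div_pow, div_le_iff₀ (by positivity)] at this
      calc _ ≤ _ := this
        _ = _ := by ring
    have h1 : ∫ x, |f x| ^ k ∂ν ≤
        ∫ x, c ^ k * (k / N * ((c ^ N)⁻¹ * |f x| ^ N) + (1 - k / N)) ∂ν :=
      integral_mono (integrable_abs_pow_of_le hf hk hN hi)
        ((((hi.const_mul _).const_mul _).add (integrable_const _)).const_mul _) hpt
    rw [integral_const_mul, integral_add ((hi.const_mul _).const_mul _) (integrable_const _),
      integral_const_mul, integral_const_mul, integral_const, probReal_univ, one_smul] at h1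
    refine h1.trans (mul_le_of_le_one_right (by positivity) ?_)
    have h2 : (c ^ N)⁻¹ * ∫ x, |f x| ^ N ∂ν ≤ 1 := by
      rw [inv_mul_le_iff₀ (by positivity), mul_one]; exact h
    have h3 : (k / N : ℝ) * ((c ^ N)⁻¹ * ∫ x, |f x| ^ N ∂ν) ≤ k / N * 1 := by gcongr
    linarith
  have hev : ∀ᶠ d in nhdsWithin c (Set.Ioi c), ∫ x, |f x| ^ k ∂ν ≤ d ^ k := by
    filter_upwards [self_mem_nhdsWithin] with d (hd : c < d)
    exact main d (hc.trans_lt hd) (h.trans (by gcongr))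
  exact ge_of_tendsto ((continuous_pow k).continuousAt.tendsto.mono_left nhdsWithin_le_nhds) hev

/-- Lyapunov's inequality for a natural exponent and a real multiple of it. -/
theorem integral_abs_pow_le_rpow {f : Ω → ℝ} (hf : AEStronglyMeasurable f ν) {N : ℕ} {L : ℝ}
    (hL : 1 < L) (hi : Integrable (fun x => |f x| ^ ((N : ℝ) * L)) ν) :
    Integrable (fun x => |f x| ^ N) ν ∧
      ∫ x, |f x| ^ N ∂ν ≤ (∫ x, |f x| ^ ((N : ℝ) * L) ∂ν) ^ (1 / L) := by
  have e : ∀ x, |f x| ^ ((N : ℝ) * L) = (|f x| ^ N) ^ L := fun x => by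
    rw [Real.rpow_mul (abs_nonneg _), Real.rpow_natCast]
  simp only [e] at hi ⊢
  have hint : Integrable (fun x => |f x| ^ N) ν := by
    refine ((integrable_const (1 : ℝ)).add hi).mono' (hf.norm.pow N) (ae_of_all _ fun x => ?_)
    rw [Real.norm_of_nonneg (by positivity), Pi.add_apply]
    have h0 : 0 ≤ |f x| ^ N := by positivity
    rcases le_total (|f x| ^ N) 1 with h | h
    · have := Real.rpow_nonneg h0 L
      linarith
    · have := Real.rpow_le_rpow_of_exponent_le h hL.le
      rw [Real.rpow_one] at this
      linarith
  refine ⟨hint, ?_⟩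
  have hj := (convexOn_rpow hL.le).map_integral_le (μ := ν) (f := fun x => |f x| ^ N)
    (Real.continuous_rpow_const (by linarith)).continuousOn isClosed_Ici
    (ae_of_all _ fun x => Set.mem_Ici.2 (by positivity)) hint hi
  rw [one_div]
  exact (Real.le_rpow_inv_iff_of_pos (integral_nonneg fun x => by positivity)
    (integral_nonneg fun x => by positivity) (by linarith)).2 hj

end Moments

theorem card_filter_card_image_le {N n k : ℕ} (hN : 0 < N) :
    (Finset.univ.filter fun τ : Fin N → Fin n => (Finset.univ.image τ).card ≤ k).card
      ≤ k ^ N * n ^ k := by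
  classical
  calc _ ≤ (Finset.univ.image
        fun q : (Fin N → Fin k) × (Fin k → Fin n) => q.2 ∘ q.1).card := by
        refine Finset.card_le_card fun τ hτ => ?_
        obtain ⟨e⟩ := Function.Embedding.nonempty_of_card_le
          (α := Finset.univ.image τ) (β := Fin k) (by
            rw [Fintype.card_coe, Fintype.card_fin]; exact (Finset.mem_filter.1 hτ).2)
        have hmem : ∀ j, τ j ∈ Finset.univ.image τ := fun j =>
          Finset.mem_image_of_mem τ (Finset.mem_univ j)
        have : Nonempty (Finset.univ.image τ) := ⟨⟨_, hmem ⟨0, hN⟩⟩⟩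
        refine Finset.mem_image.2 ⟨(fun j => e ⟨τ j, hmem j⟩,
          fun x => (Function.invFun e x).1), Finset.mem_univ _, ?_⟩
        funext j
        simp [Function.leftInverse_invFun e.injective _]
    _ ≤ _ := Finset.card_image_le
    _ = _ := by simp

theorem sum_apply_pair_eq {N n : ℕ} {b c : Fin N} (hbc : b ≠ c) (F : Fin n → Fin n → ℝ) :
    ∑ τ : Fin N → Fin n, F (τ b) (τ c) = (n : ℝ) ^ (N - 2) * ∑ i, ∑ j, F i j := by
  classical
  have hcard : ∀ i j : Fin n, ∑ τ : Fin N → Fin n,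
      (if τ b = i then (1 : ℝ) else 0) * (if τ c = j then 1 else 0) = (n : ℝ) ^ (N - 2) := by
    intro i j
    set g : Fin N → Fin n → ℝ := fun k x =>
      (if k = b then (if x = i then (1 : ℝ) else 0) else 1)
        * (if k = c then (if x = j then (1 : ℝ) else 0) else 1) with hg
    have h1 : ∀ τ : Fin N → Fin n,
        (if τ b = i then (1 : ℝ) else 0) * (if τ c = j then 1 else 0) = ∏ k, g k (τ k) := by
      intro τ
      simp only [hg, Finset.prod_mul_distrib, Finset.prod_ite_eq', Finset.mem_univ, if_true]
    simp only [h1]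
    rw [← Fintype.prod_sum, ← Finset.mul_prod_erase _ _ (Finset.mem_univ b),
      ← Finset.mul_prod_erase _ _ (Finset.mem_erase.2 ⟨hbc.symm, Finset.mem_univ c⟩)]
    rw [Finset.prod_congr rfl (g := fun _ => (n : ℝ)), Finset.prod_const]
    · simp [hg, hbc, hbc.symm, Finset.card_erase_of_mem, Nat.sub_sub]
    · intro k hk
      simp only [Finset.mem_erase] at hk
      simp [hg, hk.1, hk.2.1]
  have h2 : ∀ τ : Fin N → Fin n, F (τ b) (τ c) = ∑ i, ∑ j, F i j *
      ((if τ b = i then (1 : ℝ) else 0) * (if τ c = j then 1 else 0)) := by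
    intro τ
    simp
  simp only [h2]
  rw [Finset.sum_comm, Finset.mul_sum]
  refine Finset.sum_congr rfl fun i _ => ?_
  rw [Finset.sum_comm, Finset.mul_sum]
  refine Finset.sum_congr rfl fun j _ => ?_
  rw [← Finset.mul_sum, hcard, mul_comm]

theorem card_fiber_le_two {N n : ℕ} (τ : Fin N → Fin n)
    (h : N - 1 ≤ (Finset.univ.image τ).card) (i : Fin n) :
    (Finset.univ.filter fun b => τ b = i).card ≤ 2 := by
  have hsum := Finset.card_eq_sum_card_image τ Finset.univ
  rw [Finset.card_univ, Fintype.card_fin] at hsum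
  by_cases hi : i ∈ Finset.univ.image τ
  · rw [← Finset.add_sum_erase _ _ hi] at hsum
    have h1 := Finset.card_nsmul_le_sum ((Finset.univ.image τ).erase i)
      (fun l => (Finset.univ.filter fun b => τ b = l).card) 1 fun l hl => by
        obtain ⟨b, -, hb⟩ := Finset.mem_image.1 (Finset.mem_of_mem_erase hl)
        exact Finset.card_pos.2 ⟨b, by simpa using hb⟩
    rw [Finset.card_erase_of_mem hi, smul_eq_mul, mul_one] at h1
    have := Finset.card_pos.2 ⟨i, hi⟩
    omega
  · rw [Finset.filter_false_of_mem fun b hb (hbi : τ b = i) =>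
      hi (hbi ▸ Finset.mem_image_of_mem τ hb)]
    simp

theorem exists_card_fiber_eq_one {N n : ℕ} (hN : 7 ≤ N) (τ : Fin N → Fin n)
    (h : N - 1 ≤ (Finset.univ.image τ).card) (i j : Fin n) :
    ∃ l ∈ Finset.univ.image τ, l ≠ i ∧ l ≠ j ∧ (Finset.univ.filter fun b => τ b = l).card = 1 := by
  by_contra! hcon
  have hsum := Finset.card_eq_sum_card_image τ Finset.univ
  rw [Finset.card_univ, Fintype.card_fin] at hsum
  have h1 := Finset.card_nsmul_le_sum (((Finset.univ.image τ).erase i).erase j)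
    (fun l => (Finset.univ.filter fun b => τ b = l).card) 2 fun l hl => by
      simp only [Finset.mem_erase] at hl
      obtain ⟨b, -, hb⟩ := Finset.mem_image.1 hl.2.2
      have := Finset.card_pos.2 ⟨b, show b ∈ Finset.univ.filter fun b => τ b = l by simpa using hb⟩
      have := hcon l hl.2.2 hl.2.1 hl.1
      omega
  have h2 : ∑ l ∈ ((Finset.univ.image τ).erase i).erase j,
      (Finset.univ.filter fun b => τ b = l).card ≤
      ∑ l ∈ Finset.univ.image τ, (Finset.univ.filter fun b => τ b = l).card :=
    Finset.sum_le_sum_of_subset ((Finset.erase_subset _ _).trans (Finset.erase_subset _ _))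
  have h3 := Finset.pred_card_le_card_erase (s := Finset.univ.image τ) (a := i)
  have h4 := Finset.pred_card_le_card_erase (s := (Finset.univ.image τ).erase i) (a := j)
  rw [smul_eq_mul] at h1
  omega

theorem map_mulVec_apply_piGaussian_of_diag {ι κ : Type*} [Fintype ι] [Fintype κ]
    (B : Matrix ι κ ℝ) {i : ι} (hi : (B * Bᵀ) i i = 1) :
    (piGaussian κ).map (fun x => (B *ᵥ x) i) = gaussianReal 0 1 := by
  have := map_mulVec_apply_piGaussian B i
  simpa [hi] using this

theorem exists_abs_integral_prod_comp_le {N : ℕ} (hN : 7 ≤ N) : ∃ K : ℝ, 0 ≤ K ∧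
    ∀ {n m : ℕ} (B : Matrix (Fin n) (Fin m) ℝ), (∀ i, (B * Bᵀ) i i = 1) →
    ∀ X : Fin n → ℝ → ℝ, (∀ i, Measurable (X i)) →
    (∀ i, ∫ x, X i x ∂(gaussianReal 0 1) = 0) →
    (∀ i, Integrable (fun x => |X i x| ^ N) (gaussianReal 0 1)) → ∀ c : ℝ, 0 ≤ c →
    (∀ i, ∫ x, |X i x| ^ N ∂(gaussianReal 0 1) ≤ c ^ N) →
    ∀ τ : Fin N → Fin n, N - 1 ≤ (Finset.univ.image τ).card →
    |∫ x, ∏ j, X (τ j) ((B *ᵥ x) (τ j)) ∂(piGaussian (Fin m))|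
      ≤ K * c ^ N * ∑ b, ∑ d, (if τ b = τ d then 0 else (B * Bᵀ) (τ b) (τ d)) ^ 2 := by
  obtain ⟨K₁, hK₁, hcore⟩ := exists_abs_integral_prod_le
  refine ⟨520 * K₁ ^ N + 256, by positivity, ?_⟩
  intro n m B hB X hX hX0 hXi c hc hXc τ hτ
  have hN0 : 0 < N := by omega
  set S := ∑ b, ∑ d, (if τ b = τ d then 0 else (B * Bᵀ) (τ b) (τ d)) ^ 2 with hS
  have hS0 : 0 ≤ S := Finset.sum_nonneg fun b _ => Finset.sum_nonneg fun d _ => sq_nonneg _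
  have hcN : 0 ≤ c ^ N := by positivity
  have hmeas : ∀ i, Measurable fun x : Fin m → ℝ => (B *ᵥ x) i := fun i =>
    Continuous.measurable (by fun_prop)
  have hmap := fun i => map_mulVec_apply_piGaussian_of_diag B (hB i)
  by_cases hSs : S ≤ 1 / 256
  · set s := Finset.univ.image τ with hs
    set d : Fin n → ℕ := fun i => (Finset.univ.filter fun b => τ b = i).card with hd
    have hd2 : ∀ i, 2 * d i ≤ N := fun i => by
      have := card_fiber_le_two τ hτ i
      simp only [hd]
      omega
    have hsum : ∑ i ∈ s, d i = N := by
      have := Finset.card_eq_sum_card_image τ Finset.univ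
      rw [Finset.card_univ, Fintype.card_fin] at this
      exact this.symm
    have hscard : s.card ≤ N := by simpa using Finset.card_image_le (s := Finset.univ) (f := τ)
    have hne : Nonempty s := ⟨⟨τ ⟨0, hN0⟩, Finset.mem_image_of_mem τ (Finset.mem_univ _)⟩⟩
    have e : ∀ i x, (X i x ^ d i) ^ 2 = |X i x| ^ (2 * d i) := fun i x => by
      rw [← pow_mul, mul_comm, pow_mul, pow_mul, sq_abs]
    have key := hcore (ι := s) (κ := Fin m) (B.submatrix Subtype.val id) (fun i => hB i.1)
      (Real.sqrt S) (Real.sqrt_nonneg _)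
      (by rw [Real.sqrt_le_left (by norm_num)]; norm_num; linarith)
      (by
        rw [Real.sq_sqrt hS0]
        have h1 : ∑ i : s, ∑ j : s, (if i = j then 0 else
            (B.submatrix Subtype.val id * (B.submatrix Subtype.val id)ᵀ) i j) ^ 2
            = ∑ i ∈ s, ∑ j ∈ s, (if i = j then 0 else (B * Bᵀ) i j) ^ 2 := by
          rw [← Finset.sum_coe_sort s]
          refine Finset.sum_congr rfl fun i _ => ?_
          rw [← Finset.sum_coe_sort s]
          refine Finset.sum_congr rfl fun j _ => ?_
          by_cases hij : i = j
          · simp [hij]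
          · rw [if_neg hij, if_neg fun h => hij (Subtype.ext h)]
            rfl
        rw [h1]
        refine (Finset.sum_image_le_of_nonneg fun i _ =>
          Finset.sum_nonneg fun j _ => sq_nonneg _).trans (Finset.sum_le_sum fun b _ => ?_)
        exact Finset.sum_image_le_of_nonneg fun i _ => sq_nonneg _)
      (fun i x => X i.1 x ^ d i.1) (fun i => (hX i.1).pow_const _)
      (fun i => by
        simp only [e]
        exact integrable_abs_pow_of_le (hX i.1).aestronglyMeasurable (hd2 i.1) hN0 (hXi i.1))
      (fun i j => by
        obtain ⟨l, hl, hli, hlj, hl1⟩ := exists_card_fiber_eq_one hN τ hτ i.1 j.1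
        refine ⟨⟨l, hl⟩, fun h => hli (congrArg Subtype.val h),
          fun h => hlj (congrArg Subtype.val h), ?_⟩
        have : d l = 1 := hl1
        simp only [this, pow_one, hX0])
    have hprod : ∀ x, ∏ j, X (τ j) ((B *ᵥ x) (τ j))
        = ∏ i : s, X i.1 ((B.submatrix Subtype.val id *ᵥ x) i) ^ d i.1 := by
      intro x
      rw [Finset.prod_comp (fun i => X i ((B *ᵥ x) i)) τ, ← Finset.prod_coe_sort]
      rfl
    simp only [hprod]
    refine key.trans ?_
    rw [Real.sq_sqrt hS0, Fintype.card_coe]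
    have hP : ∏ i : s, Real.sqrt (∫ x, (X i.1 x ^ d i.1) ^ 2 ∂(gaussianReal 0 1)) ≤ c ^ N := by
      calc _ ≤ ∏ i : s, c ^ d i.1 := by
            refine Finset.prod_le_prod (fun i _ => Real.sqrt_nonneg _) fun i _ => ?_
            rw [Real.sqrt_le_left (by positivity), ← pow_mul, mul_comm]
            simp only [e]
            exact integral_abs_pow_le_of_le (hd2 i.1) hN0 (hX i.1).aestronglyMeasurable
              (hXi i.1) hc (hXc i.1)
        _ = c ^ N := by
            rw [Finset.prod_coe_sort s fun i => c ^ d i, Finset.prod_pow_eq_pow_sum, hsum]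
    calc _ ≤ 520 * K₁ ^ N * S * c ^ N := by
          gcongr
      _ ≤ 520 * K₁ ^ N * S * c ^ N + 256 * (S * c ^ N) := by
          have := mul_nonneg hS0 hcN
          linarith
      _ = _ := by ring
  · have htriv := abs_integral_prod_le_of_abs_pow (ν := piGaussian (Fin m)) hN0
      (V := fun j x => X (τ j) ((B *ᵥ x) (τ j)))
      (fun j => ((hX _).comp (hmeas _)).aestronglyMeasurable)
      (fun j => by
        have := hXi (τ j)
        rw [← hmap (τ j)] at this
        exact this.comp_measurable (hmeas (τ j)))
      (M := c ^ N) (fun j => by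
        refine le_trans (le_of_eq ?_) (hXc (τ j))
        rw [← hmap (τ j), integral_map (hmeas (τ j)).aemeasurable]
        exact ((hX _).norm.pow_const N).aestronglyMeasurable)
    refine htriv.trans ?_
    push Not at hSs
    have h1 : 0 ≤ 520 * K₁ ^ N * (c ^ N * S) := by positivity
    nlinarith [mul_nonneg hcN (sub_nonneg.2 hSs.le)]

theorem exists_integral_sum_pow_le {N : ℕ} (hN : 7 ≤ N) : ∃ K : ℝ, 0 ≤ K ∧
    ∀ {n m : ℕ} (B : Matrix (Fin n) (Fin m) ℝ), (∀ i, (B * Bᵀ) i i = 1) →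
    ∀ X : Fin n → ℝ → ℝ, (∀ i, Measurable (X i)) →
    (∀ i, ∫ x, X i x ∂(gaussianReal 0 1) = 0) →
    (∀ i, Integrable (fun x => |X i x| ^ N) (gaussianReal 0 1)) → ∀ c : ℝ, 0 ≤ c →
    (∀ i, ∫ x, |X i x| ^ N ∂(gaussianReal 0 1) ≤ c ^ N) →
    ∫ x, (∑ i, X i ((B *ᵥ x) i)) ^ N ∂(piGaussian (Fin m))
      ≤ K * (1 + ∑ i, ∑ j, (if i = j then 0 else (B * Bᵀ) i j) ^ 2)
        * (n : ℝ) ^ (N - 2) * c ^ N := by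
  obtain ⟨K, hK, hgood⟩ := exists_abs_integral_prod_comp_le hN
  refine ⟨(N - 2 : ℕ) ^ N + K * N ^ 2, by positivity, ?_⟩
  intro n m B hB X hX hX0 hXi c hc hXc
  have hN0 : 0 < N := by omega
  have hcN : 0 ≤ c ^ N := by positivity
  have hmeas : ∀ i, Measurable fun x : Fin m → ℝ => (B *ᵥ x) i := fun i =>
    Continuous.measurable (by fun_prop)
  have hmap := fun i => map_mulVec_apply_piGaussian_of_diag B (hB i)
  have hVm : ∀ (τ : Fin N → Fin n) j, AEStronglyMeasurable
      (fun x => X (τ j) ((B *ᵥ x) (τ j))) (piGaussian (Fin m)) := fun τ j =>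
    ((hX _).comp (hmeas _)).aestronglyMeasurable
  have hVi : ∀ (τ : Fin N → Fin n) j, Integrable
      (fun x => |X (τ j) ((B *ᵥ x) (τ j))| ^ N) (piGaussian (Fin m)) := fun τ j => by
    have := hXi (τ j)
    rw [← hmap (τ j)] at this
    exact this.comp_measurable (hmeas (τ j))
  have hVc : ∀ (τ : Fin N → Fin n) j,
      ∫ x, |X (τ j) ((B *ᵥ x) (τ j))| ^ N ∂(piGaussian (Fin m)) ≤ c ^ N := fun τ j => by
    refine le_trans (le_of_eq ?_) (hXc (τ j))
    rw [← hmap (τ j), integral_map (hmeas (τ j)).aemeasurable]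
    exact ((hX _).norm.pow_const N).aestronglyMeasurable
  set D : Fin n → Fin n → ℝ := fun i j => (if i = j then 0 else (B * Bᵀ) i j) ^ 2 with hD
  have hD0 : ∀ i j, 0 ≤ D i j := fun i j => sq_nonneg _
  set S := ∑ i, ∑ j, D i j with hS
  have hS0 : 0 ≤ S := Finset.sum_nonneg fun i _ => Finset.sum_nonneg fun j _ => hD0 i j
  have hpt : ∀ τ : Fin N → Fin n,
      ∫ x, ∏ j, X (τ j) ((B *ᵥ x) (τ j)) ∂(piGaussian (Fin m))
      ≤ (if (Finset.univ.image τ).card ≤ N - 2 then c ^ N else 0)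
        + K * c ^ N * ∑ b, ∑ d, D (τ b) (τ d) := by
    intro τ
    have h0 : 0 ≤ K * c ^ N * ∑ b, ∑ d, D (τ b) (τ d) :=
      mul_nonneg (by positivity)
        (Finset.sum_nonneg fun b _ => Finset.sum_nonneg fun d _ => hD0 _ _)
    split_ifs with h
    · have := (abs_le.1 (abs_integral_prod_le_of_abs_pow hN0 (hVm τ) (hVi τ) (hVc τ))).2
      linarith
    · rw [zero_add]
      exact (le_abs_self _).trans (hgood B hB X hX hX0 hXi c hc hXc τ (by omega))
  have hpair : ∀ b d : Fin N, ∑ τ : Fin N → Fin n, D (τ b) (τ d) ≤ (n : ℝ) ^ (N - 2) * S := by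
    intro b d
    by_cases hbd : b = d
    · subst hbd
      simp only [hD, if_true, ne_eq, OfNat.ofNat_ne_zero, not_false_eq_true, zero_pow,
        Finset.sum_const_zero]
      positivity
    · exact (sum_apply_pair_eq hbd D).le
  calc _ = ∑ τ : Fin N → Fin n, ∫ x, ∏ j, X (τ j) ((B *ᵥ x) (τ j)) ∂(piGaussian (Fin m)) := by
        simp only [Fintype.sum_pow]
        exact integral_finsetSum _ fun τ _ => integrable_prod_of_abs_pow hN0 (hVm τ) (hVi τ)
    _ ≤ ∑ τ : Fin N → Fin n, ((if (Finset.univ.image τ).card ≤ N - 2 then c ^ N else 0)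
        + K * c ^ N * ∑ b, ∑ d, D (τ b) (τ d)) := Finset.sum_le_sum fun τ _ => hpt τ
    _ = (Finset.univ.filter fun τ : Fin N → Fin n =>
          (Finset.univ.image τ).card ≤ N - 2).card * c ^ N
        + K * c ^ N * ∑ b, ∑ d, ∑ τ : Fin N → Fin n, D (τ b) (τ d) := by
        rw [Finset.sum_add_distrib, ← Finset.sum_filter, Finset.sum_const, nsmul_eq_mul,
          ← Finset.mul_sum, Finset.sum_comm]
        congr 2
        exact Finset.sum_congr rfl fun b _ => Finset.sum_comm
    _ ≤ ((N - 2 : ℕ) ^ N * (n : ℝ) ^ (N - 2)) * c ^ N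
        + K * c ^ N * ∑ _b : Fin N, ∑ _d : Fin N, (n : ℝ) ^ (N - 2) * S := by
        gcongr with b _ d _
        · exact_mod_cast card_filter_card_image_le hN0
        · exact hpair b d
    _ = (n : ℝ) ^ (N - 2) * c ^ N * ((N - 2 : ℕ) ^ N + K * N ^ 2 * S) := by
        simp only [Finset.sum_const, Finset.card_univ, Fintype.card_fin, nsmul_eq_mul]
        ring
    _ ≤ (n : ℝ) ^ (N - 2) * c ^ N * (((N - 2 : ℕ) ^ N + K * N ^ 2) * (1 + S)) := by
        gcongr
        have h1 : 0 ≤ ((N - 2 : ℕ) : ℝ) ^ N * S := by positivity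
        have h2 : 0 ≤ K * N ^ 2 := by positivity
        linarith
    _ = _ := by ring

theorem sum_offDiag_eq_two_mul {n : ℕ} (F : Fin n → Fin n → ℝ) (hF : ∀ i j, F i j = F j i) :
    ∑ i, ∑ j, (if i = j then 0 else F i j)
      = 2 * ∑ q ∈ Finset.univ.filter (fun q : Fin n × Fin n => q.1 < q.2), F q.1 q.2 := by
  have h1 : ∀ i j, (if i = j then 0 else F i j)
      = (if i < j then F i j else 0) + (if j < i then F j i else 0) := by
    intro i j
    rcases lt_trichotomy i j with h | h | h
    · simp [h, h.ne, h.not_gt]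
    · simp [h]
    · simp [h, h.ne', h.not_gt, hF i j]
  simp only [h1, Finset.sum_add_distrib]
  rw [Finset.sum_comm (f := fun i j => if j < i then F j i else 0), ← two_mul,
    Finset.sum_filter, Fintype.sum_prod_type]
/-- **LLN for images of weakly correlated Gaussians (Lᵗʰ-root form).** Fix an integer `p ≥ 6`
and `R ≥ 0`.  There is a constant `𝒞`, depending only on `p` and `R`, such that: for every
`L > 1`, every `z ~ N(0, K)` with `K` positive semidefinite, positive diagonal, correlation
matrix `C` satisfying `∑_{i<j} C_{ij}² ≤ R`, and all functions `φ i` with means `μs i` and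
finite centered moments of order `2pL` under `N(0, K_{ii})`, the average
`Q = (1/n) ∑ i, φ i (z i)` satisfies
`E[(Q − E Q)^{2p}] ≤ 𝒞 n^{-1.5 + 1/L} ((1/n) ∑ i E_{x~N(0,K_{ii})}[(φ i x − μs i)^{2pL}])^{1/L}`. -/
theorem weakly_correlated_gaussian_lln_Lroot
    (p : ℕ) (hp : 6 ≤ p) (R : ℝ) :
    ∃ 𝒞 : ℝ, ∀ (L : ℝ), 1 < L →
      ∀ {Ω : Type} [MeasureSpace Ω] [IsProbabilityMeasure (volume : Measure Ω)],
      ∀ (n : ℕ) (hn : 0 < n) (K : Matrix (Fin n) (Fin n) ℝ),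
      K.PosSemidef → (∀ i, 0 < K i i) →
      (∑ q ∈ Finset.univ.filter (fun q : Fin n × Fin n => q.1 < q.2),
          (K q.1 q.2 / (Real.sqrt (K q.1 q.1) * Real.sqrt (K q.2 q.2))) ^ 2 ≤ R) →
      ∀ (z : Ω → Fin n → ℝ), Measurable z →
      ∀ (m : ℕ) (B : Matrix (Fin n) (Fin m) ℝ), K = B * Bᵀ →
      Measure.map z volume
        = Measure.map B.mulVec (Measure.pi fun _ : Fin m => gaussianReal 0 1) →
      ∀ (φ : Fin n → ℝ → ℝ), (∀ i, Measurable (φ i)) →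
      ∀ (μs : Fin n → ℝ),
      (∀ i, μs i = ∫ x, φ i x ∂(gaussianReal 0 (Real.toNNReal (K i i)))) →
      (∀ i, Integrable (φ i) (gaussianReal 0 (Real.toNNReal (K i i)))) →
      (∀ i, Integrable (fun x => |φ i x - μs i| ^ ((2 * p : ℝ) * L))
          (gaussianReal 0 (Real.toNNReal (K i i)))) →
      ∫ ω, ((1 / n : ℝ) * ∑ i, φ i (z ω i)
            - ∫ ω', (1 / n : ℝ) * ∑ i, φ i (z ω' i)) ^ (2 * p)
        ≤ 𝒞 * (n : ℝ) ^ (-(1.5 : ℝ) + 1 / L)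
            * ((1 / n : ℝ) * ∑ i, ∫ x, |φ i x - μs i| ^ ((2 * p : ℝ) * L)
                  ∂(gaussianReal 0 (Real.toNNReal (K i i)))) ^ (1 / L) := by
  obtain ⟨K₀, hK₀, hmain⟩ := exists_integral_sum_pow_le (N := 2 * p) (by omega)
  refine ⟨K₀ * (1 + 2 * R), ?_⟩
  intro L hL Ω _ _ n hn K hKpsd hKpos hR z hz m B hKB hlaw φ hφ μs hμ hφi hφm
  have hn0 : (0 : ℝ) < n := by exact_mod_cast hn
  have hn1 : (1 : ℝ) ≤ n := by exact_mod_cast hn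
  set σ : Fin n → ℝ := fun i => Real.sqrt (K i i) with hσ
  have hσpos : ∀ i, 0 < σ i := fun i => Real.sqrt_pos.2 (hKpos i)
  have hσsq : ∀ i, σ i * σ i = K i i := fun i => Real.mul_self_sqrt (hKpos i).le
  set B' : Matrix (Fin n) (Fin m) ℝ := fun i k => B i k / σ i with hB'
  have hBB' : ∀ i j, (B' * B'ᵀ) i j = K i j / (σ i * σ j) := by
    intro i j
    rw [hKB, Matrix.mul_apply, Matrix.mul_apply, Finset.sum_div]
    exact Finset.sum_congr rfl fun k _ => by
      simp only [hB', Matrix.transpose_apply]; exact div_mul_div_comm _ _ _ _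
  have hdiag : ∀ i, (B' * B'ᵀ) i i = 1 := fun i => by
    rw [hBB', hσsq, div_self (hKpos i).ne']
  have hmul : ∀ i x, (B *ᵥ x) i = σ i * (B' *ᵥ x) i := by
    intro i x
    simp only [Matrix.mulVec, dotProduct, Finset.mul_sum]
    refine Finset.sum_congr rfl fun k _ => ?_
    simp only [hB']
    field_simp [(hσpos i).ne']
  have hgauss : ∀ i, gaussianReal 0 (Real.toNNReal (K i i))
      = (gaussianReal 0 1).map fun y => σ i * y := by
    intro i
    rw [gaussianReal_map_const_mul, mul_zero, mul_one]
    congr 1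
    ext
    rw [Real.coe_toNNReal _ (hKpos i).le, NNReal.coe_mk, sq, hσsq]
  have hσm : ∀ i, Measurable fun y : ℝ => σ i * y := fun i => measurable_const_mul _
  set X : Fin n → ℝ → ℝ := fun i y => φ i (σ i * y) - μs i with hX
  have hXm : ∀ i, Measurable (X i) := fun i => ((hφ i).comp (hσm i)).sub_const _
  have hφi' : ∀ i, Integrable (fun y => φ i (σ i * y)) (gaussianReal 0 1) := fun i => by
    have := hφi i
    rw [hgauss] at this
    exact this.comp_measurable (hσm i)
  have hμ' : ∀ i, ∫ y, φ i (σ i * y) ∂(gaussianReal 0 1) = μs i := fun i => by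
    rw [hμ i, hgauss, integral_map (hσm i).aemeasurable (hφ i).aestronglyMeasurable]
  have hX0 : ∀ i, ∫ y, X i y ∂(gaussianReal 0 1) = 0 := fun i => by
    simp only [hX]
    rw [integral_sub (hφi' i) (integrable_const _), hμ']
    simp
  have hXL : ∀ i, Integrable (fun y => |X i y| ^ (((2 * p : ℕ) : ℝ) * L)) (gaussianReal 0 1) :=
    fun i => by
      have := hφm i
      rw [hgauss] at this
      push_cast
      exact this.comp_measurable (hσm i)
  have hXW : ∀ i, ∫ y, |X i y| ^ (((2 * p : ℕ) : ℝ) * L) ∂(gaussianReal 0 1)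
      = ∫ x, |φ i x - μs i| ^ ((2 * p : ℝ) * L) ∂(gaussianReal 0 (Real.toNNReal (K i i))) :=
    fun i => by
      rw [hgauss, integral_map (hσm i).aemeasurable]
      · push_cast
        rfl
      · exact (((hφ i).sub_const _).norm.pow_const _).aestronglyMeasurable
  simp only [← hXW]
  set W := ∑ i, ∫ y, |X i y| ^ (((2 * p : ℕ) : ℝ) * L) ∂(gaussianReal 0 1) with hW
  have hWi0 : ∀ i, 0 ≤ ∫ y, |X i y| ^ (((2 * p : ℕ) : ℝ) * L) ∂(gaussianReal 0 1) := fun i =>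
    integral_nonneg fun y => by positivity
  have hW0 : 0 ≤ W := Finset.sum_nonneg fun i _ => hWi0 i
  set M := W ^ (1 / L) with hM
  have hM0 : 0 ≤ M := Real.rpow_nonneg hW0 _
  have hcN : (M ^ (((2 * p : ℕ) : ℝ)⁻¹)) ^ (2 * p) = M := Real.rpow_inv_natCast_pow hM0 (by omega)
  have hly := fun i => integral_abs_pow_le_rpow (ν := gaussianReal 0 1)
    (hXm i).aestronglyMeasurable hL (hXL i)
  have hXM : ∀ i, ∫ y, |X i y| ^ (2 * p) ∂(gaussianReal 0 1) ≤ M := fun i =>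
    (hly i).2.trans (Real.rpow_le_rpow (hWi0 i)
      (Finset.single_le_sum (fun j _ => hWi0 j) (Finset.mem_univ i)) (by positivity))
  have hbd := hmain B' hdiag X hXm hX0 (fun i => (hly i).1) (M ^ (((2 * p : ℕ) : ℝ)⁻¹))
    (Real.rpow_nonneg hM0 _) (by simpa only [hcN] using hXM)
  rw [hcN] at hbd
  have hsum : ∑ i, ∑ j, (if i = j then 0 else (B' * B'ᵀ) i j) ^ 2 ≤ 2 * R := by
    have h := sum_offDiag_eq_two_mul (fun i j => (K i j / (σ i * σ j)) ^ 2) fun i j => by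
      have : K j i = K i j := by
        rw [hKB, Matrix.mul_apply, Matrix.mul_apply]
        exact Finset.sum_congr rfl fun k _ => mul_comm _ _
      rw [this, mul_comm (σ i)]
    simp only [ite_pow, hBB', ne_eq, OfNat.ofNat_ne_zero, not_false_eq_true, zero_pow]
    rw [h]
    linarith
  -- transfer to the standard Gaussian space
  have htrans : ∀ Ψ : (Fin n → ℝ) → ℝ, Measurable Ψ →
      ∫ ω, Ψ (z ω) = ∫ x, Ψ (B *ᵥ x) ∂(piGaussian (Fin m)) := by
    intro Ψ hΨ
    rw [← integral_map (φ := z) hz.aemeasurable hΨ.aestronglyMeasurable, hlaw,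
      integral_map (φ := B.mulVec) (Continuous.measurable (by fun_prop)).aemeasurable
        hΨ.aestronglyMeasurable]
  have hsumm : Measurable fun v : Fin n → ℝ => (1 / n : ℝ) * ∑ i, φ i (v i) :=
    (Finset.measurable_fun_sum _ fun i _ => (hφ i).comp (measurable_pi_apply i)).const_mul _
  have hmeas : ∀ i, Measurable fun x : Fin m → ℝ => (B' *ᵥ x) i := fun i =>
    Continuous.measurable (by fun_prop)
  have hmap := fun i => map_mulVec_apply_piGaussian_of_diag B' (hdiag i)
  have hEQ : ∫ ω, (1 / n : ℝ) * ∑ i, φ i (z ω i) = (1 / n : ℝ) * ∑ i, μs i := by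
    rw [htrans _ hsumm, integral_const_mul, integral_finsetSum]
    · congr 1
      refine Finset.sum_congr rfl fun i _ => ?_
      simp only [hmul]
      rw [← hμ' i, ← hmap i, integral_map (hmeas i).aemeasurable]
      exact ((hφ i).comp (hσm i)).aestronglyMeasurable
    · intro i _
      simp only [hmul]
      have := hφi' i
      rw [← hmap i] at this
      exact this.comp_measurable (hmeas i)
  rw [hEQ, htrans (fun v => ((1 / n : ℝ) * ∑ i, φ i (v i) - (1 / n : ℝ) * ∑ i, μs i) ^ (2 * p))
    ((hsumm.sub_const _).pow_const _)]
  have hfactor : ∀ x : Fin m → ℝ,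
      ((1 / n : ℝ) * ∑ i, φ i ((B *ᵥ x) i) - (1 / n : ℝ) * ∑ i, μs i) ^ (2 * p)
        = ((n : ℝ) ^ (2 * p))⁻¹ * (∑ i, X i ((B' *ᵥ x) i)) ^ (2 * p) := by
    intro x
    rw [← mul_sub, ← Finset.sum_sub_distrib, mul_pow, one_div, inv_pow]
    simp only [hmul, hX]
  simp only [hfactor]
  rw [integral_const_mul, Real.mul_rpow (by positivity) hW0, ← hM]
  have hpow : (n : ℝ) ^ (-(1.5 : ℝ) + 1 / L) * (1 / n : ℝ) ^ (1 / L) = (n : ℝ) ^ (-(1.5 : ℝ)) := by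
    rw [Real.rpow_add hn0, one_div (n : ℝ), Real.inv_rpow hn0.le, mul_assoc,
      mul_inv_cancel₀ (Real.rpow_pos_of_pos hn0 _).ne', mul_one]
  have hpow2 : ((n : ℝ) ^ (2 * p))⁻¹ * (n : ℝ) ^ (2 * p - 2) ≤ (n : ℝ) ^ (-(1.5 : ℝ)) := by
    have e : (n : ℝ) ^ (2 * p) = (n : ℝ) ^ (2 * p - 2) * (n : ℝ) ^ 2 := by
      rw [← pow_add]; congr 1; omega
    rw [e, mul_inv, mul_right_comm, inv_mul_cancel₀ (by positivity), one_mul,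
      ← Real.rpow_natCast, ← Real.rpow_neg hn0.le]
    exact Real.rpow_le_rpow_of_exponent_le hn1 (by norm_num)
  have hR0 : 0 ≤ R := le_trans (Finset.sum_nonneg fun q _ => sq_nonneg _) hR
  calc _ ≤ ((n : ℝ) ^ (2 * p))⁻¹ * (K₀ * (1 + 2 * R) * (n : ℝ) ^ (2 * p - 2) * M) := by
        gcongr
        refine hbd.trans ?_
        gcongr
    _ = K₀ * (1 + 2 * R) * M * (((n : ℝ) ^ (2 * p))⁻¹ * (n : ℝ) ^ (2 * p - 2)) := by ring
    _ ≤ K₀ * (1 + 2 * R) * M * (n : ℝ) ^ (-(1.5 : ℝ)) := by gcongr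
    _ = _ := by rw [← hpow]; ring
end

section
/- Let H ∈ R^{n×l} be a matrix with HᵀH invertible, and let Π_H = H (HᵀH)^{-1} Hᵀ be the associated orthogonal projection matrix onto the column space of H. Fix α ∈ [n], let H_α ∈ R^{1×l} be the α-th row of H, and let H_{−α} ∈ R^{(n−1)×l} be H with the α-th row removed. If H_{−α}ᵀ H_{−α} is invertible, then the α-th diagonal entry of Π_H equals (Π_H)_{αα} = c / (1 + c), where c = H_α (H_{−α}ᵀ H_{−α})^{-1} H_αᵀ. -/
set_option autoImplicit false

open Matrix

/-- The Gram matrix splits into the Gram matrix without row `a` and a rank-one term. -/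
theorem Matrix.transpose_mul_self_eq_add_vecMulVec {m k R : Type*} [Fintype m] [DecidableEq m]
    [CommSemiring R] (H : Matrix m k R) (a : m) :
    Hᵀ * H = (Matrix.of fun (b : {b : m // b ≠ a}) j => H b.1 j)ᵀ *
        (Matrix.of fun (b : {b : m // b ≠ a}) j => H b.1 j) + vecMulVec (H a) (H a) := by
  ext i j
  simp only [mul_apply, add_apply, transpose_apply, of_apply, vecMulVec_apply]
  rw [Fintype.sum_eq_add_sum_subtype_ne (fun b => H b i * H b j) a, add_comm]

/-- The quadratic form of the inverse of a rank-one update, at the updating vector. -/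
theorem Matrix.dotProduct_inv_add_vecMulVec_mulVec {k K : Type*} [Fintype k] [DecidableEq k]
    [Field K] (B : Matrix k k K) (v : k → K) (hB : IsUnit B.det)
    (hA : IsUnit (B + vecMulVec v v).det) :
    v ⬝ᵥ (B + vecMulVec v v)⁻¹ *ᵥ v = (v ⬝ᵥ B⁻¹ *ᵥ v) / (1 + v ⬝ᵥ B⁻¹ *ᵥ v) := by
  set A := B + vecMulVec v v with hAdef
  set c := v ⬝ᵥ B⁻¹ *ᵥ v with hc
  have hAw : A *ᵥ (B⁻¹ *ᵥ v) = (1 + c) • v := by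
    rw [hAdef, add_mulVec, mulVec_mulVec, mul_nonsing_inv _ hB, one_mulVec, vecMulVec_mulVec,
      ← hc, add_smul, one_smul, op_smul_eq_smul]
  have hw : B⁻¹ *ᵥ v = (1 + c) • A⁻¹ *ᵥ v := by
    rw [← mulVec_smul, ← hAw, mulVec_mulVec, nonsing_inv_mul _ hA, one_mulVec]
  have hcA : c = (1 + c) * (v ⬝ᵥ A⁻¹ *ᵥ v) := by
    rw [← smul_eq_mul, ← dotProduct_smul, ← hw]
  have hne : 1 + c ≠ 0 := by
    intro h
    have hc0 : c = 0 := by rw [hcA, h, zero_mul]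
    simp [hc0] at h
  rw [eq_div_iff hne, mul_comm, ← hcA]

/-- **Leave-one-out formula for diagonal entries of a projection matrix.**
If `HᵀH` is invertible and `Π_H = H (HᵀH)⁻¹ Hᵀ`, then for any row index `α`, writing
`H₋α` for `H` with the `α`-th row removed, if `H₋αᵀ H₋α` is invertible then
`(Π_H)_{αα} = c / (1 + c)` where `c = H_α (H₋αᵀ H₋α)⁻¹ H_αᵀ`. -/
theorem projection_diag_leave_one_out
    (n l : ℕ) (H : Matrix (Fin n) (Fin l) ℝ) (α : Fin n)
    (hH : IsUnit (Hᵀ * H).det)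
    (Hm : Matrix {β : Fin n // β ≠ α} (Fin l) ℝ)
    (hHm : Hm = Matrix.of (fun β j => H β.1 j))
    (hHminv : IsUnit (Hmᵀ * Hm).det) :
    (H * (Hᵀ * H)⁻¹ * Hᵀ) α α
      = (H α ⬝ᵥ (Hmᵀ * Hm)⁻¹.mulVec (H α)) / (1 + H α ⬝ᵥ (Hmᵀ * Hm)⁻¹.mulVec (H α)) := by
  subst hHm
  have hsplit := Matrix.transpose_mul_self_eq_add_vecMulVec H α
  have hentry : (H * (Hᵀ * H)⁻¹ * Hᵀ) α α = H α ⬝ᵥ (Hᵀ * H)⁻¹ *ᵥ H α := by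
    rw [Matrix.mul_assoc]
    rfl
  rw [hentry, hsplit]
  exact Matrix.dotProduct_inv_add_vecMulVec_mulVec _ _ hHminv (hsplit ▸ hH)
end
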